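/- For a subset S ⊆ S_n set Š := Σ_{w∈S} (−q⁻¹)^{ℓ(w)} T_w ∈ A, and define x̌_f := (H_f⁻¹)ˇ · Š_{{2f+1,…,n}} · Ê_f · Ȟ_f for 0 ≤ f ≤ ⌊n/2⌋, where H_f⁻¹ = {d⁻¹ : d ∈ H_f(n)} and S_{{2f+1,…,n}} is the subgroup of S_n of permutations fixing 1,…,2f pointwise. Assume q + rq^{2+2f−2n} ≠ 0 for all 1 ≤ f ≤ ⌊n/2⌋, and define č_0 := 1 and č_f := (q^{3−4f}(1 − q^{2f})/(q + rq^{2+2f−2n})) · č_{f−1} for 1 ≤ f ≤ ⌊n/2⌋. Then the element y := Σ_{f=0}^{⌊n/2⌋} č_f x̌_f satisfies y·E_i = 0 and y·T_i = −q⁻¹·y for all i = 1,…,n−1 (so y is, up to a scalar, the antisymmetrizer of the BMW algebra). -/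

import Mathlib

open Finset
open scoped Pointwise

namespace BMWPaper

/-- The Coxeter length of a permutation of `Fin n`: the number of inversions. -/
def len {n : ℕ} (w : Equiv.Perm (Fin n)) : ℕ :=
  (Finset.univ.filter (fun p : Fin n × Fin n => p.1 < p.2 ∧ w p.2 < w p.1)).card

/-- `sGen n i` is the adjacent transposition `s_i = (i, i+1)` (1-based) in `S_n`;
it is the identity for out-of-range `i`. -/
def sGen (n i : ℕ) : Equiv.Perm (Fin n) :=
  if h : 1 ≤ i ∧ i < n then Equiv.swap ⟨i - 1, by omega⟩ ⟨i, h.2⟩ else 1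

/-- `pimg d i` is the (1-based) image `(i)d` of the point `i ∈ {1,…,n}` under the
*right* action of the permutation `d` (permutations act on points on the right,
so that `(a)(στ) = ((a)σ)τ` for the group multiplication `σ * τ`);
the junk value `0` is returned for out-of-range `i`. -/
def pimg {n : ℕ} (d : Equiv.Perm (Fin n)) (i : ℕ) : ℕ :=
  if h : i - 1 < n then ((d⁻¹ ⟨i - 1, h⟩ : Fin n) : ℕ) + 1 else 0

open scoped Classical in
/-- `Hset n f` is the set `H_f(n)` of all `d ∈ S_n` such that
`(1)d < (3)d < ⋯ < (2f-1)d`, `(2i-1)d < (2i)d` for `i = 1,…,f`, and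
`(2f+1)d < (2f+2)d < ⋯ < (n)d`. -/
noncomputable def Hset (n f : ℕ) : Finset (Equiv.Perm (Fin n)) :=
  Finset.univ.filter (fun d =>
    (∀ i ∈ Finset.Icc 1 (f - 1), pimg d (2 * i - 1) < pimg d (2 * i + 1)) ∧
    (∀ i ∈ Finset.Icc 1 f, pimg d (2 * i - 1) < pimg d (2 * i)) ∧
    (∀ j ∈ Finset.Icc (2 * f + 1) (n - 1), pimg d j < pimg d (j + 1)))

/-- The index of the block of the composition `μ` containing the (0-based) point `k`. -/
def blockOf (μ : List ℕ) (k : ℕ) : ℕ :=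
  ((List.range μ.length).filter (fun j => (μ.take (j + 1)).sum ≤ k)).length

open scoped Classical in
/-- The Young subgroup `S_μ` of `S_n` associated with a composition `μ` of `n`,
as the set of permutations preserving each of the consecutive blocks of `μ`. -/
noncomputable def youngSet (n : ℕ) (μ : List ℕ) : Finset (Equiv.Perm (Fin n)) :=
  Finset.univ.filter (fun w => ∀ a : Fin n, blockOf μ ((w a : ℕ)) = blockOf μ (a : ℕ))

open scoped Classical in
/-- The set `D_μ` of minimal-length right coset representatives of `S_μ` in `S_n`:
the elements of minimal length in their right coset `S_μ d`. -/
noncomputable def Dset (n : ℕ) (μ : List ℕ) : Finset (Equiv.Perm (Fin n)) :=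
  Finset.univ.filter (fun d => ∀ u ∈ youngSet n μ, len d ≤ len (u * d))

/-- The identification of `Fin m` with the block `[k, k+m)` of `Fin n` (0-based). -/
def shiftEquiv (n k m : ℕ) (h : k + m ≤ n) :
    Fin m ≃ {a : Fin n // k ≤ (a : ℕ) ∧ (a : ℕ) < k + m} where
  toFun b := ⟨⟨k + (b : ℕ), by have := b.isLt; omega⟩, by
    constructor
    · exact Nat.le_add_right _ _
    · have := b.isLt; simp only [Fin.val_mk]; omega⟩
  invFun a := ⟨(a : Fin n) - k, by have := a.2; omega⟩
  left_inv b := by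
    apply Fin.ext
    simp
  right_inv a := by
    apply Subtype.ext
    apply Fin.ext
    have := a.2
    simp only []
    omega

open scoped Classical in
/-- The embedding of `S_m` into `S_n` as the group of permutations of the
(1-based) block `{k+1, …, k+m}` of `{1, …, n}`. -/
noncomputable def shiftEmb (n k m : ℕ) (w : Equiv.Perm (Fin m)) : Equiv.Perm (Fin n) :=
  if h : k + m ≤ n then w.extendDomain (shiftEquiv n k m h) else 1

open scoped Classical in
/-- The subgroup of `S_n` of permutations fixing the (1-based) points `1, …, k`. -/
noncomputable def fixSet (n k : ℕ) : Finset (Equiv.Perm (Fin n)) :=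
  Finset.univ.filter (fun w => ∀ a : Fin n, (a : ℕ) < k → w a = a)


/-- `bbs n i` is the permutation `𝕤_i = s_{2i} s_{2i-1} s_{2i+1} s_{2i} = (2i-1, 2i+1)(2i, 2i+2)`. -/
def bbs (n i : ℕ) : Equiv.Perm (Fin n) :=
  sGen n (2 * i) * sGen n (2 * i - 1) * sGen n (2 * i + 1) * sGen n (2 * i)

open scoped Classical in
/-- The set `𝔻_{(1,f-1)} = {𝕤_1 𝕤_2 ⋯ 𝕤_k : k = 0, …, f-1}` in `S_{2f}`. -/
noncomputable def bbD1 (f : ℕ) : Finset (Equiv.Perm (Fin (2 * f))) :=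
  (Finset.range f).image (fun k => ((List.range k).map (fun j => bbs (2 * f) (j + 1))).prod)

open scoped Classical in
/-- The set `𝔻_{(1,f-2)}^{{2,…,f}} = {𝕤_2 𝕤_3 ⋯ 𝕤_k : k = 1, …, f-1}` in `S_{2f}`. -/
noncomputable def bbD1' (f : ℕ) : Finset (Equiv.Perm (Fin (2 * f))) :=
  (Finset.Icc 1 (f - 1)).image
    (fun k => ((List.range (k - 1)).map (fun j => bbs (2 * f) (j + 2))).prod)

open scoped Classical in
/-- `H_f^{(a)} = {d ∈ H_f(n) : (1)d⁻¹ = 1, (2)d⁻¹ = 2}`. -/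
noncomputable def HsetA (n f : ℕ) : Finset (Equiv.Perm (Fin n)) :=
  (Hset n f).filter (fun d => pimg d⁻¹ 1 = 1 ∧ pimg d⁻¹ 2 = 2)

open scoped Classical in
/-- `H_f^{(b)} = {d ∈ H_f(n) : (1)d⁻¹ = 1, (2)d⁻¹ = 3}`. -/
noncomputable def HsetB (n f : ℕ) : Finset (Equiv.Perm (Fin n)) :=
  (Hset n f).filter (fun d => pimg d⁻¹ 1 = 1 ∧ pimg d⁻¹ 2 = 3)

open scoped Classical in
/-- `H_f^{(c)} = {d ∈ H_f(n) : (1)d⁻¹ = 1, (2)d⁻¹ = 2f+1}`. -/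
noncomputable def HsetC (n f : ℕ) : Finset (Equiv.Perm (Fin n)) :=
  (Hset n f).filter (fun d => pimg d⁻¹ 1 = 1 ∧ pimg d⁻¹ 2 = 2 * f + 1)

open scoped Classical in
/-- `H_f^{(d)} = {d ∈ H_f(n) : (1)d⁻¹ = 2f+1, (2)d⁻¹ = 1}`. -/
noncomputable def HsetD (n f : ℕ) : Finset (Equiv.Perm (Fin n)) :=
  (Hset n f).filter (fun d => pimg d⁻¹ 1 = 2 * f + 1 ∧ pimg d⁻¹ 2 = 1)

open scoped Classical in
/-- `H_f^{(e)} = {d ∈ H_f(n) : (1)d⁻¹ = 2f+1, (2)d⁻¹ = 2f+2}`. -/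
noncomputable def HsetE (n f : ℕ) : Finset (Equiv.Perm (Fin n)) :=
  (Hset n f).filter (fun d => pimg d⁻¹ 1 = 2 * f + 1 ∧ pimg d⁻¹ 2 = 2 * f + 2)

section Algebra

variable {F : Type*} [Field F] {A : Type*} [Ring A] [Algebra F A]

/-- For a set `S` of permutations, `hat c Tw S = Σ_{w ∈ S} c^{ℓ(w)} T_w`. -/
noncomputable def hat {n : ℕ} (c : F) (Tw : Equiv.Perm (Fin n) → A)
    (S : Finset (Equiv.Perm (Fin n))) : A :=
  ∑ w ∈ S, c ^ len w • Tw w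

/-- `Ehat E f = E_1 E_3 ⋯ E_{2f-1}`. -/
def Ehat (E : ℕ → A) (f : ℕ) : A := ((List.range f).map (fun i => E (2 * i + 1))).prod

/-- `Tprod T a b = T_a T_{a+1} ⋯ T_b` (the empty product `1` if `b < a`). -/
def Tprod (T : ℕ → A) (a b : ℕ) : A := ((List.range (b + 1 - a)).map (fun t => T (a + t))).prod

/-- `sDesc n a b = s_a s_{a-1} ⋯ s_b` (descending product of adjacent transpositions). -/
def sDesc (n a b : ℕ) : Equiv.Perm (Fin n) :=
  ((List.range (a + 1 - b)).map (fun j => sGen n (a - j))).prod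

/-- The data of a Birman–Murakami–Wenzl algebra structure: an `F`-algebra `A`
with invertible elements `T_1, …, T_{n-1}` and elements `E_1, …, E_{n-1}`
satisfying the BMW relations, together with a map `w ↦ T_w` from `S_n` to `A`
with `T_id = 1`, `T_{s_i} = T_i` and `T_{uv} = T_u T_v` whenever lengths add. -/
structure BMWData (F : Type*) [Field F] (A : Type*) [Ring A] [Algebra F A]
    (n : ℕ) (q r : F) where
  T : ℕ → A
  Tinv : ℕ → A
  E : ℕ → A
  Tw : Equiv.Perm (Fin n) → A
  hq : q ≠ 0
  hr : r ≠ 0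
  hqq : q - q⁻¹ ≠ 0
  T_mul_Tinv : ∀ i, 1 ≤ i → i ≤ n - 1 → T i * Tinv i = 1
  Tinv_mul_T : ∀ i, 1 ≤ i → i ≤ n - 1 → Tinv i * T i = 1
  skein : ∀ i, 1 ≤ i → i ≤ n - 1 → T i - Tinv i = (q - q⁻¹) • (1 - E i)
  Esq : ∀ i, 1 ≤ i → i ≤ n - 1 → E i * E i = (1 + (r - r⁻¹) / (q - q⁻¹)) • E i
  braid : ∀ i, 1 ≤ i → i + 1 ≤ n - 1 → T i * T (i + 1) * T i = T (i + 1) * T i * T (i + 1)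
  T_comm : ∀ i j, 1 ≤ i → i ≤ n - 1 → 1 ≤ j → j ≤ n - 1 → (i + 1 < j ∨ j + 1 < i) →
    T i * T j = T j * T i
  EEE₁ : ∀ i, 1 ≤ i → i + 1 ≤ n - 1 → E i * E (i + 1) * E i = E i
  EEE₂ : ∀ i, 1 ≤ i → i + 1 ≤ n - 1 → E (i + 1) * E i * E (i + 1) = E (i + 1)
  TTE₁ : ∀ i, 1 ≤ i → i + 1 ≤ n - 1 → T i * T (i + 1) * E i = E (i + 1) * E i
  TTE₂ : ∀ i, 1 ≤ i → i + 1 ≤ n - 1 → T (i + 1) * T i * E (i + 1) = E i * E (i + 1)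
  ET : ∀ i, 1 ≤ i → i ≤ n - 1 → E i * T i = r⁻¹ • E i
  TE : ∀ i, 1 ≤ i → i ≤ n - 1 → T i * E i = r⁻¹ • E i
  ETE₁ : ∀ i, 1 ≤ i → i + 1 ≤ n - 1 → E i * T (i + 1) * E i = r • E i
  ETE₂ : ∀ i, 1 ≤ i → i + 1 ≤ n - 1 → E (i + 1) * T i * E (i + 1) = r • E (i + 1)
  Tw_one : Tw 1 = 1
  Tw_s : ∀ i, 1 ≤ i → i ≤ n - 1 → Tw (sGen n i) = T i
  Tw_mul : ∀ u v : Equiv.Perm (Fin n), len (u * v) = len u + len v →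
    Tw (u * v) = Tw u * Tw v

/-- The scalars `a_f` defined by `a_0 = 1` and `a_i = a_{i-1} · Σ_{k=0}^{i-1} q^{2k}`. -/
noncomputable def aseq (q : F) : ℕ → F
  | 0 => 1
  | (i + 1) => aseq q i * (∑ k ∈ Finset.range (i + 1), q ^ (2 * k))


/-- The scalars `c_f` defined by `c_0 = 1` and
`c_f = -((q^{4f-3} - q^{2f-3})/(r q^{2n-2f-2} - q⁻¹)) · c_{f-1}`. -/
noncomputable def cseq (q r : F) (n : ℕ) : ℕ → F
  | 0 => 1
  | (f + 1) =>
      -((q ^ (4 * ((f : ℤ) + 1) - 3) - q ^ (2 * ((f : ℤ) + 1) - 3)) /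
          (r * q ^ (2 * (n : ℤ) - 2 * ((f : ℤ) + 1) - 2) - q⁻¹)) * cseq q r n f

/-- The scalars `č_f` defined by `č_0 = 1` and
`č_f = (q^{3-4f}(1 - q^{2f})/(q + r q^{2+2f-2n})) · č_{f-1}` (with integer exponents). -/
noncomputable def ccseq (q r : F) (n : ℕ) : ℕ → F
  | 0 => 1
  | (f + 1) =>
      (q ^ ((3 : ℤ) - 4 * ((f : ℤ) + 1)) * (1 - q ^ (2 * (f + 1))) /
          (q + r * q ^ ((2 : ℤ) + 2 * ((f : ℤ) + 1) - 2 * (n : ℤ)))) * ccseq q r n f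

/-- The element `x_f = (H_f⁻¹)^ · Ŝ_{{2f+1,…,n}} · Ê_f · Ĥ_f` of the BMW algebra. -/
noncomputable def xEl {F : Type*} [Field F] {A : Type*} [Ring A] [Algebra F A]
    {n : ℕ} {q r : F} (D : BMWData F A n q r) (f : ℕ) : A :=
  hat q D.Tw ((Hset n f).image (fun d => d⁻¹)) * hat q D.Tw (fixSet n (2 * f)) *
    Ehat D.E f * hat q D.Tw (Hset n f)

/-- The element `x̌_f = (H_f⁻¹)ˇ · Š_{{2f+1,…,n}} · Ê_f · Ȟ_f` of the BMW algebra,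
where `ˇ` is formed with `-q⁻¹` in place of `q`. -/
noncomputable def xElCheck {F : Type*} [Field F] {A : Type*} [Ring A] [Algebra F A]
    {n : ℕ} {q r : F} (D : BMWData F A n q r) (f : ℕ) : A :=
  hat (-q⁻¹) D.Tw ((Hset n f).image (fun d => d⁻¹)) * hat (-q⁻¹) D.Tw (fixSet n (2 * f)) *
    Ehat D.E f * hat (-q⁻¹) D.Tw (Hset n f)

end Algebra

namespace BMWData

variable {F : Type*} [Field F] {A : Type*} [Ring A] [Algebra F A] {n : ℕ} {q r : F}
variable (D : BMWData F A n q r)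

theorem T_sq {i : ℕ} (hi : 1 ≤ i) (hin : i < n) :
    D.T i * D.T i = 1 + (q - q⁻¹) • D.T i - ((q - q⁻¹) * r⁻¹) • D.E i := by
  have h := congrArg (· * D.T i) (D.skein i hi (by omega))
  simp only [sub_mul, smul_mul_assoc, one_mul, D.Tinv_mul_T i hi (by omega),
    D.ET i hi (by omega)] at h
  linear_combination (norm := module) h

theorem E_eq {i : ℕ} (hi : 1 ≤ i) (hin : i < n) :
    D.E i = 1 - (q - q⁻¹)⁻¹ • (D.T i - D.Tinv i) := by
  rw [D.skein i hi (by omega), smul_smul, inv_mul_cancel₀ D.hqq, one_smul, sub_sub_cancel]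

/-- Intertwining relations between the `T`s carry over to the `E`s. -/
theorem mul_E_of_mul_T {x : A} {i j : ℕ} (hi : 1 ≤ i) (hin : i < n) (hj : 1 ≤ j) (hjn : j < n)
    (h : x * D.T i = D.T j * x) : x * D.E i = D.E j * x := by
  have h' : x * D.Tinv i = D.Tinv j * x := by
    calc x * D.Tinv i = D.Tinv j * D.T j * x * D.Tinv i := by
          rw [D.Tinv_mul_T j hj (by omega), one_mul]
      _ = D.Tinv j * x * (D.T i * D.Tinv i) := by simp only [mul_assoc, ← h]
      _ = _ := by rw [D.T_mul_Tinv i hi (by omega), mul_one]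
  rw [D.E_eq hi hin, D.E_eq hj hjn]
  simp only [mul_sub, sub_mul, mul_one, one_mul, mul_smul_comm, smul_mul_assoc, h, h']

theorem commute_T_T {i j : ℕ} (hi : 1 ≤ i) (hin : i < n) (hj : 1 ≤ j) (hjn : j < n)
    (hij : i + 1 < j ∨ j + 1 < i) : Commute (D.T i) (D.T j) :=
  D.T_comm i j hi (by omega) hj (by omega) hij

theorem commute_E_of_commute_T {x : A} {i : ℕ} (hi : 1 ≤ i) (hin : i < n)
    (h : Commute x (D.T i)) : Commute x (D.E i) :=
  D.mul_E_of_mul_T hi hin hi hin h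

theorem commute_E_T {i j : ℕ} (hi : 1 ≤ i) (hin : i < n) (hj : 1 ≤ j) (hjn : j < n)
    (hij : i + 1 < j ∨ j + 1 < i) : Commute (D.E i) (D.T j) :=
  (D.commute_E_of_commute_T hi hin (D.commute_T_T hj hjn hi hin hij.symm)).symm

theorem commute_E_E {i j : ℕ} (hi : 1 ≤ i) (hin : i < n) (hj : 1 ≤ j) (hjn : j < n)
    (hij : i + 1 < j ∨ j + 1 < i) : Commute (D.E i) (D.E j) :=
  D.commute_E_of_commute_T hj hjn (D.commute_E_T hi hin hj hjn hij)

theorem E_mul_T_mul_T {i : ℕ} (hi : 1 ≤ i) (hin : i + 1 < n) :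
    D.E i * D.T (i + 1) * D.T i = D.E i * D.E (i + 1) := by
  rw [← D.TTE₂ i hi (by omega), mul_assoc]
  refine (D.mul_E_of_mul_T (by omega) (by omega) hi (by omega) ?_).symm
  rw [← D.braid i hi (by omega), mul_assoc]

theorem E_succ_mul_T_mul_T {i : ℕ} (hi : 1 ≤ i) (hin : i + 1 < n) :
    D.E (i + 1) * D.T i * D.T (i + 1) = D.E (i + 1) * D.E i := by
  rw [← D.TTE₁ i hi (by omega), mul_assoc]
  refine (D.mul_E_of_mul_T hi (by omega) (by omega) (by omega) ?_).symm
  rw [D.braid i hi (by omega), mul_assoc]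

/-- `x` is a left multiple of `E i`. -/
def Ends (x : A) (i : ℕ) : Prop := ∃ w, x = w * D.E i

variable {D}

theorem Ends.mul_of_commute {x y : A} {i : ℕ} (h : D.Ends x i) (hy : Commute y (D.E i)) :
    D.Ends (x * y) i := by
  obtain ⟨w, rfl⟩ := h
  exact ⟨w * y, by rw [mul_assoc, mul_assoc, hy.eq]⟩

theorem Ends.mul_T {x : A} {i : ℕ} (h : D.Ends x i) (hi : 1 ≤ i) (hin : i < n) :
    x * D.T i = r⁻¹ • x := by
  obtain ⟨w, rfl⟩ := h
  rw [mul_assoc, D.ET i hi (by omega), mul_smul_comm]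

theorem Ends.mul_T_mul_T {x : A} {i : ℕ} (h : D.Ends x i) (hi : 1 ≤ i) (hin : i + 1 < n) :
    x * D.T (i + 1) * D.T i = x * D.E (i + 1) := by
  obtain ⟨w, rfl⟩ := h
  simpa only [mul_assoc] using congrArg (w * ·) (D.E_mul_T_mul_T hi hin)

theorem Ends.mul_T_mul_E {x : A} {i : ℕ} (h : D.Ends x i) (hi : 1 ≤ i) (hin : i + 1 < n) :
    x * D.T (i + 1) * D.E i = r • x := by
  obtain ⟨w, rfl⟩ := h
  rw [mul_assoc, mul_assoc, ← mul_assoc (D.E i), D.ETE₁ i hi (by omega), mul_smul_comm]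

theorem Ends.mul_T_mul_T' {x : A} {i : ℕ} (h : D.Ends x (i + 1)) (hi : 1 ≤ i) (hin : i + 1 < n) :
    x * D.T i * D.T (i + 1) = x * D.E i := by
  obtain ⟨w, rfl⟩ := h
  simpa only [mul_assoc] using congrArg (w * ·) (D.E_succ_mul_T_mul_T hi hin)

theorem Ends.mul_T_mul_E' {x : A} {i : ℕ} (h : D.Ends x (i + 1)) (hi : 1 ≤ i) (hin : i + 1 < n) :
    x * D.T i * D.E (i + 1) = r • x := by
  obtain ⟨w, rfl⟩ := h
  rw [mul_assoc, mul_assoc, ← mul_assoc (D.E (i + 1)), D.ETE₂ i hi (by omega), mul_smul_comm]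

theorem Ends.mul_E_mul_T' {x : A} {i : ℕ} (h : D.Ends x (i + 1)) (hi : 1 ≤ i) (hin : i + 1 < n) :
    x * D.E i * D.T (i + 1) =
      x * D.T i + (q - q⁻¹) • (x * D.E i) - (q - q⁻¹) • x := by
  rw [← h.mul_T_mul_T' hi hin, mul_assoc (x * D.T i), D.T_sq (by omega) hin]
  simp only [mul_add, mul_sub, mul_one, mul_smul_comm, h.mul_T_mul_E' hi hin, h.mul_T_mul_T' hi hin]
  have := D.hr
  match_scalars <;> field_simp

/-- Two adjacent arcs may be interchanged. -/
theorem Ends.mul_swap {x : A} {i : ℕ} (h : D.Ends x i) (h2 : D.Ends x (i + 2)) (hi : 1 ≤ i)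
    (hin : i + 2 < n) :
    x * D.T (i + 1) * D.T i * D.T (i + 2) * D.T (i + 1) = x := by
  obtain ⟨w, rfl⟩ := h2
  rw [h.mul_T_mul_T hi (by omega), mul_assoc w,  ← D.E_succ_mul_T_mul_T (i := i + 1) (by omega) hin]
  have := D.E_mul_T_mul_T (i := i + 1) (by omega) hin
  rw [D.E_succ_mul_T_mul_T (i := i + 1) (by omega) hin]
  simp only [mul_assoc] at this ⊢
  rw [this, ← mul_assoc (D.E (i + 2)), D.EEE₂ (i + 1) (by omega) (by omega)]

theorem braid_shift {i : ℕ} (hi : 1 ≤ i) (hin : i + 1 < n) :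
    D.T i * D.T (i + 1) * D.T i = D.T (i + 1) * (D.T i * D.T (i + 1)) := by
  rw [D.braid i hi (by omega), mul_assoc]

end BMWData

namespace BMWData

variable {F : Type*} [Field F] {A : Type*} [Ring A] [Algebra F A] {n : ℕ} {q r : F}
variable (D : BMWData F A n q r)

/-- The signed sum `1 + q T_m + q² T_m T_{m+1} + ⋯` with `k` terms. -/
def Cc : ℕ → ℕ → A
  | _, 0 => 0
  | m, k + 1 => 1 + q • (D.T m * Cc (m + 1) k)

/-- The descending product `T_{a+l-1} ⋯ T_{a+1} T_a`. -/
def Dn (a : ℕ) : ℕ → A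
  | 0 => 1
  | l + 1 => D.T (a + l) * Dn a l

/-- The recursive form of the sum over `H_f`, for the points `m, …, m + k - 1`. -/
def Hh : ℕ → ℕ → ℕ → A
  | 0, _, _ => 1
  | _ + 1, _, 0 => 0
  | _ + 1, _, 1 => 0
  | f + 1, m, k + 2 => Hh f (m + 2) k * D.Cc (m + 1) (k + 1) +
      q ^ (2 * f + 2) • (D.Dn m (2 * f + 2) * Hh (f + 1) (m + 1) (k + 1))

theorem Cc_zero (m : ℕ) : D.Cc m 0 = 0 := by rw [Cc]

theorem Cc_succ (m k : ℕ) : D.Cc m (k + 1) = 1 + q • (D.T m * D.Cc (m + 1) k) := by rw [Cc]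

theorem Cc_one (m : ℕ) : D.Cc m 1 = 1 := by rw [Cc_succ, Cc_zero, mul_zero, smul_zero, add_zero]

theorem Dn_zero (a : ℕ) : D.Dn a 0 = 1 := rfl

theorem Dn_succ (a l : ℕ) : D.Dn a (l + 1) = D.T (a + l) * D.Dn a l := rfl

theorem Dn_succ' (a l : ℕ) : D.Dn a (l + 1) = D.Dn (a + 1) l * D.T a := by
  induction l with
  | zero => simp [Dn]
  | succ l ih => rw [Dn_succ, ih, Dn_succ, ← mul_assoc, ← add_assoc, add_right_comm]

theorem Hh_zero (m k : ℕ) : D.Hh 0 m k = 1 := by rw [Hh]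

theorem Hh_succ (f m k : ℕ) : D.Hh (f + 1) m (k + 2) = D.Hh f (m + 2) k * D.Cc (m + 1) (k + 1) +
      q ^ (2 * f + 2) • (D.Dn m (2 * f + 2) * D.Hh (f + 1) (m + 1) (k + 1)) := by rw [Hh]

theorem Hh_eq_zero {f m k : ℕ} (h : k < 2 * f) : D.Hh f m k = 0 := by
  induction f generalizing m k with
  | zero => omega
  | succ f ihf =>
    induction k generalizing m with
    | zero => rw [Hh]
    | succ k ihk =>
      cases k with
      | zero => rw [Hh]
      | succ k =>
        rw [Hh_succ, ihf (by omega), ihk (by omega), zero_mul, mul_zero, smul_zero, add_zero]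

theorem Hh_one_succ (m k : ℕ) : D.Hh 1 m (k + 2) =
    D.Cc (m + 1) (k + 1) + q ^ 2 • (D.T (m + 1) * D.T m * D.Hh 1 (m + 1) (k + 1)) := by
  rw [Hh_succ, Hh_zero, one_mul, Dn_succ, Dn_succ, Dn_zero, mul_one, add_zero]

theorem Hh_one_one (m : ℕ) : D.Hh 1 m 1 = 0 := D.Hh_eq_zero (by omega)

theorem Hh_one_zero (m : ℕ) : D.Hh 1 m 0 = 0 := D.Hh_eq_zero (by omega)

theorem Hh_one_two (m : ℕ) : D.Hh 1 m 2 = 1 := by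
  rw [Hh_one_succ, Hh_one_one, mul_zero, smul_zero, add_zero, Cc_one]

variable {D}

theorem commute_Cc {x : A} {m k : ℕ} (h : ∀ j, m ≤ j → j + 1 < m + k → Commute x (D.T j)) :
    Commute x (D.Cc m k) := by
  induction k generalizing m with
  | zero => rw [Cc_zero]; exact Commute.zero_right x
  | succ k ih =>
    rw [Cc_succ]
    cases k with
    | zero => rw [Cc_zero, mul_zero, smul_zero, add_zero]; exact Commute.one_right x
    | succ k =>
      exact (Commute.one_right x).add_right (((h m le_rfl (by omega)).mul_right
        (ih fun j hj hj' => h j (by omega) (by omega))).smul_right q)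

theorem commute_Dn {x : A} {a l : ℕ} (h : ∀ j, a ≤ j → j < a + l → Commute x (D.T j)) :
    Commute x (D.Dn a l) := by
  induction l with
  | zero => rw [Dn_zero]; exact Commute.one_right x
  | succ l ih =>
    exact (h _ (by omega) (by omega)).mul_right (ih fun j hj hj' => h j hj (by omega))

theorem commute_Hh {x : A} {f m k : ℕ} (h : ∀ j, m ≤ j → j + 1 < m + k → Commute x (D.T j)) :
    Commute x (D.Hh f m k) := by
  induction f generalizing m k with
  | zero => rw [Hh_zero]; exact Commute.one_right x
  | succ f ihf =>
    induction k generalizing m with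
    | zero => rw [Hh]; exact Commute.zero_right x
    | succ k ihk =>
      cases k with
      | zero => rw [Hh]; exact Commute.zero_right x
      | succ k =>
        by_cases hk : k < 2 * f
        · rw [D.Hh_eq_zero (by omega)]; exact Commute.zero_right x
        rw [Hh_succ]
        refine ((ihf fun j hj hj' => h j (by omega) (by omega)).mul_right
          (commute_Cc fun j hj hj' => h j (by omega) (by omega))).add_right ?_
        rcases Nat.eq_or_lt_of_le (not_lt.1 hk) with hk' | hk'
        · rw [D.Hh_eq_zero (f := f + 1) (by omega), mul_zero, smul_zero]
          exact Commute.zero_right x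
        exact ((commute_Dn fun j hj hj' => h j (by omega) (by omega)).mul_right
          (ihk fun j hj hj' => h j (by omega) (by omega))).smul_right _

theorem commute_T_Cc {i m k : ℕ} (hi : 1 ≤ i) (hin : i < n) (hm : 1 ≤ m) (hk : m + k ≤ n + 1)
    (h : i + 1 < m ∨ m + k ≤ i) : Commute (D.T i) (D.Cc m k) :=
  commute_Cc fun _ _ _ => D.commute_T_T hi hin (by omega) (by omega) (by omega)

theorem commute_T_Hh {i f m k : ℕ} (hi : 1 ≤ i) (hin : i < n) (hm : 1 ≤ m) (hk : m + k ≤ n + 1)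
    (h : i + 1 < m ∨ m + k ≤ i) : Commute (D.T i) (D.Hh f m k) :=
  commute_Hh fun _ _ _ => D.commute_T_T hi hin (by omega) (by omega) (by omega)

theorem commute_T_Dn {i a l : ℕ} (hi : 1 ≤ i) (hin : i < n) (ha : 1 ≤ a) (hl : a + l ≤ n)
    (h : i + 1 < a ∨ a + l < i) : Commute (D.T i) (D.Dn a l) :=
  commute_Dn fun _ _ _ => D.commute_T_T hi hin (by omega) (by omega) (by omega)

theorem Cc_mul_Cc {m k : ℕ} (hm : 1 ≤ m) (hk : m + k ≤ n) :
    D.Cc (m + 1) k * D.Cc m (k + 1) = (1 + q • D.T m) * D.Hh 1 m (k + 1) := by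
  induction k generalizing m with
  | zero => rw [Cc_zero, Hh_one_one, zero_mul, mul_zero]
  | succ k ih =>
    have h1 : D.T (m + 1) * D.Cc (m + 2) k * D.T m * D.Cc (m + 1) (k + 1) =
        D.T (m + 1) * D.T m * ((1 + q • D.T (m + 1)) * D.Hh 1 (m + 1) (k + 1)) := by
      rw [← ih (by omega) (by omega), mul_assoc (D.T (m + 1)),
        ← (commute_T_Cc (by omega) (by omega) (by omega) (by omega) (by omega)).eq]
      simp only [mul_assoc]
    cases k with
    | zero =>
      rw [Cc_succ _ m, Cc_one, Hh_one_two]; simp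
    | succ k =>
    have h2 := D.braid m hm (by omega)
    have h3 : D.Cc (m + 1) (k + 2) * D.T m * D.Cc (m + 1) (k + 2) =
        D.T m * D.Cc (m + 1) (k + 2) + q • (D.T (m + 1) * D.Cc (m + 2) (k + 1) * D.T m *
          D.Cc (m + 1) (k + 2)) := by
      conv_lhs => arg 1; arg 1; rw [Cc_succ]
      simp only [add_mul, one_mul, smul_mul_assoc]
    rw [Hh_one_succ, Cc_succ _ m]
    simp only [mul_add, add_mul, mul_one, one_mul, mul_smul_comm, smul_mul_assoc, smul_add,
      smul_smul, ← mul_assoc] at h1 h3 ⊢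
    rw [h3, h1, h2]
    module

variable (D) in
theorem Hh_one_expand (m k : ℕ) :
    D.Hh 1 m (k + 2) = 1 + q • (D.T (m + 1) * (1 + q • D.T m) * D.Cc (m + 2) k) +
      q ^ 4 • (D.T (m + 1) * D.T m * D.T (m + 2) * D.T (m + 1) * D.Hh 1 (m + 2) k) := by
  cases k with
  | zero => rw [Hh_one_two, Cc_zero, Hh_one_zero]; simp
  | succ k =>
    rw [Hh_one_succ, Hh_one_succ, Cc_succ]
    simp only [mul_add, add_mul, mul_one, mul_smul_comm, smul_mul_assoc, smul_add,
      smul_smul, ← mul_assoc]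
    module

theorem one_add_mul_sub {i : ℕ} (hi : 1 ≤ i) (hin : i < n) :
    (1 + q • D.T i) * (D.T i - q • 1) = -(q * (q - q⁻¹) * r⁻¹) • D.E i := by
  have h := D.T_sq hi hin
  have := D.hq
  simp only [add_mul, mul_sub, smul_mul_assoc, mul_smul_comm, mul_one, one_mul, h, smul_add,
    smul_sub]
  match_scalars <;> field_simp <;> ring

/-- Key relation between the rotated and the unrotated sums over one arc. -/
theorem Ends.mul_Hh_one {y : A} {m k : ℕ} (h1 : D.Ends y m) (h2 : D.Ends y (m + 2)) (hm : 1 ≤ m)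
    (hk : m + k + 3 ≤ n) :
    y * D.Cc (m + 3) (k + 1) * D.T (m + 1) * (D.T m - q • 1) * D.Cc (m + 2) (k + 2) =
      -(q * (q - q⁻¹)) • (y * D.Hh 1 (m + 2) (k + 2)) := by
  have hA : D.Cc (m + 3) (k + 1) * D.Cc (m + 2) (k + 2) =
      (1 + q • D.T (m + 2)) * D.Hh 1 (m + 2) (k + 2) := Cc_mul_Cc (by omega) (by omega)
  have c0 : Commute (D.T m) (D.Cc (m + 3) (k + 1)) :=
    commute_T_Cc (by omega) (by omega) (by omega) (by omega) (by omega)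
  have c1 : Commute (D.T (m + 1)) (D.Cc (m + 3) (k + 1)) :=
    commute_T_Cc (by omega) (by omega) (by omega) (by omega) (by omega)
  have hB : y * D.T (m + 1) * (D.T m - q • 1) * (1 + q • D.T (m + 2)) = -(q * (q - q⁻¹)) • y := by
    have e1 := h1.mul_T_mul_T hm (by omega)
    have e2 := h2.mul_T_mul_T' (i := m + 1) (by omega) (by omega)
    have e3 := h2.mul_E_mul_T' (i := m + 1) (by omega) (by omega)
    simp only [add_assoc, Nat.reduceAdd] at e2 e3
    simp only [mul_add, mul_sub, sub_mul, mul_one, mul_smul_comm, smul_mul_assoc, e1, e2, e3]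
    have := D.hq
    match_scalars <;> field_simp <;> ring
  calc _ = y * (D.Cc (m + 3) (k + 1) * (D.T (m + 1) * (D.T m - q • 1))) *
        D.Cc (m + 2) (k + 2) := by simp only [mul_assoc]
    _ = y * D.T (m + 1) * (D.T m - q • 1) * (D.Cc (m + 3) (k + 1) * D.Cc (m + 2) (k + 2)) := by
        rw [← (c1.mul_left (c0.sub_left ((Commute.one_left _).smul_left q))).eq]
        simp only [mul_assoc]
    _ = _ := by rw [hA, ← mul_assoc, hB, smul_mul_assoc]

end BMWData

/-- The quantum integer `1 + q² + ⋯ + q^{2(k-1)}`. -/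
def qnum {F : Type*} [Field F] (q : F) (k : ℕ) : F := ∑ j ∈ range k, q ^ (2 * j)

theorem qnum_zero {F : Type*} [Field F] (q : F) : qnum q 0 = 0 := by simp [qnum]

theorem qnum_one {F : Type*} [Field F] (q : F) : qnum q 1 = 1 := by simp [qnum]

theorem qnum_succ {F : Type*} [Field F] (q : F) (k : ℕ) :
    qnum q (k + 1) = qnum q k + q ^ (2 * k) := by rw [qnum, sum_range_succ, ← qnum]

theorem qnum_succ' {F : Type*} [Field F] (q : F) (k : ℕ) :
    qnum q (k + 1) = 1 + q ^ 2 * qnum q k := by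
  induction k with
  | zero => simp [qnum]
  | succ k ih =>
    rw [qnum_succ q (k + 1)]
    linear_combination ih - q ^ 2 * qnum_succ q k

theorem mul_qnum {F : Type*} [Field F] {q : F} (hq : q ≠ 0) (k : ℕ) :
    q * (q - q⁻¹) * qnum q k = q ^ (2 * k) - 1 := by
  have : q * (q - q⁻¹) = q ^ 2 - 1 := by field_simp
  rw [this]
  induction k with
  | zero => simp [qnum]
  | succ k ih => rw [qnum_succ, mul_add, ih]; ring

namespace BMWData

variable {F : Type*} [Field F] {A : Type*} [Ring A] [Algebra F A] {n : ℕ} {q r : F}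
variable {D : BMWData F A n q r}

theorem mul_T_cancel {a b : A} {i : ℕ} (hi : 1 ≤ i) (hin : i < n)
    (h : a * D.T i = b * D.T i) : a = b := by
  have := congrArg (· * D.Tinv i) h
  simpa only [mul_assoc, D.T_mul_Tinv i hi (by omega), mul_one] using this

theorem T_mul_Dn {j m L : ℕ} (hm : 1 ≤ m) (hj : m ≤ j) (hjL : j + 2 ≤ m + L) (hL : m + L ≤ n) :
    D.Dn m L * D.T (j + 1) = D.T j * D.Dn m L := by
  induction L with
  | zero => omega
  | succ L ih =>
    rw [Dn_succ]
    rcases Nat.lt_or_ge (m + L) (j + 2) with h | h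
    · obtain ⟨L, rfl⟩ : ∃ L', L = L' + 1 := ⟨L - 1, by omega⟩
      obtain rfl : j = m + L := by omega
      rw [Dn_succ, ← mul_assoc, ← mul_assoc, ← mul_assoc, ← add_assoc,
        D.braid (m + L) (by omega) (by omega), mul_assoc, mul_assoc (D.T (m + L + 1) * _),
        (commute_T_Dn (by omega) (by omega) hm (by omega) (by omega)).eq]
    · rw [mul_assoc, ih (by omega) (by omega), ← mul_assoc, ← mul_assoc,
        (D.commute_T_T (by omega) (by omega) (by omega) (by omega) (by omega)).eq]

theorem Dn_mul_Dn {k m L : ℕ} (hm : 1 ≤ m) (hkL : k < L) (hL : m + L ≤ n) :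
    D.Dn m k * D.Dn m L = D.Dn m L * D.Dn (m + 1) k := by
  induction k with
  | zero => rw [Dn_zero, Dn_zero, one_mul, mul_one]
  | succ k ih =>
    rw [Dn_succ, Dn_succ, mul_assoc, ih (by omega), ← mul_assoc, ← mul_assoc,
      add_right_comm m 1 k, T_mul_Dn hm (by omega) (by omega) hL]

theorem Ends.mul_Dn {x : A} {j m L : ℕ} (h : D.Ends x j) (hm : 1 ≤ m) (hj : m ≤ j)
    (hjL : j + 2 ≤ m + L) (hL : m + L ≤ n) : D.Ends (x * D.Dn m L) (j + 1) := by
  obtain ⟨w, rfl⟩ := h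
  exact ⟨w * D.Dn m L, by
    rw [mul_assoc, mul_assoc, D.mul_E_of_mul_T (by omega) (by omega) (by omega) (by omega)
      (T_mul_Dn hm hj hjL hL)]⟩

theorem Ends.mul_Hh {x : A} {i f m k : ℕ} (h : D.Ends x i) (hi : 1 ≤ i) (hin : i < n)
    (hm : 1 ≤ m) (hk : m + k ≤ n + 1) (h' : i + 1 < m ∨ m + k ≤ i) :
    D.Ends (x * D.Hh f m k) i :=
  h.mul_of_commute (D.commute_E_of_commute_T hi hin (commute_T_Hh hi hin hm hk h').symm)

/-- Rotating a family of adjacent arcs past one further arc. -/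
theorem mul_Dn_mul_Dn {x : A} {m k : ℕ} (h : ∀ i ≤ k, D.Ends x (m + 2 * i)) (hm : 1 ≤ m)
    (hk : m + 2 * k < n) : x * D.Dn m (2 * k) * D.Dn (m + 1) (2 * k) = x := by
  induction k with
  | zero => rw [mul_zero, Dn_zero, Dn_zero, mul_one, mul_one]
  | succ k ih =>
    have e1 : D.Dn m (2 * (k + 1)) = D.T (m + 2 * k + 1) * D.T (m + 2 * k) * D.Dn m (2 * k) := by
      rw [mul_assoc]; rfl
    have e2 : D.Dn (m + 1) (2 * (k + 1)) =
        D.T (m + 2 * k + 2) * D.T (m + 2 * k + 1) * D.Dn (m + 1) (2 * k) := by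
      rw [mul_assoc, show m + 2 * k + 2 = m + 1 + (2 * k + 1) by omega, add_right_comm m (2 * k) 1]
      rfl
    have c1 : Commute (D.T (m + 2 * k + 2) * D.T (m + 2 * k + 1)) (D.Dn m (2 * k)) :=
      (commute_T_Dn (by omega) (by omega) hm (by omega) (by omega)).mul_left
        (commute_T_Dn (by omega) (by omega) hm (by omega) (by omega))
    calc _ = x * D.T (m + 2 * k + 1) * D.T (m + 2 * k) * (D.Dn m (2 * k) *
          (D.T (m + 2 * k + 2) * D.T (m + 2 * k + 1))) * D.Dn (m + 1) (2 * k) := by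
          rw [e1, e2]; simp only [mul_assoc]
      _ = x * D.T (m + 2 * k + 1) * D.T (m + 2 * k) * D.T (m + 2 * k + 2) * D.T (m + 2 * k + 1) *
          D.Dn m (2 * k) * D.Dn (m + 1) (2 * k) := by rw [← c1.eq]; simp only [mul_assoc]
      _ = _ := by
        rw [(h k (by omega)).mul_swap (h (k + 1) le_rfl) (by omega) (by omega),
          ih (fun i hi => h i (by omega)) (by omega)]

/-- `mul_Cc_mul_Dn_mul_Hh` and `mul_Hh_mul_Hh_one`, proved by a simultaneous induction. -/
theorem mul_Cc_Dn_Hh_and_mul_Hh_Hh_one (N : ℕ) : ∀ (f l m : ℕ) (x : A), N = 2 * f + l → 1 ≤ m → m + N + 1 ≤ n →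
    (∀ i ≤ f, D.Ends x (m + 2 * i)) →
    x * D.Cc (m + 2 * f + 1) (l + 1) * D.Dn m (2 * f) * D.Hh f (m + 1) (N + 1) =
      x * D.Hh f (m + 2) N * D.Cc (m + 1) (N + 1) ∧
    x * D.Hh f (m + 2) N * D.Hh 1 m (N + 2) = qnum q (f + 1) • (x * D.Hh (f + 1) m (N + 2)) := by
  induction N using Nat.strong_induction_on with
  | _ N IH =>
  have mul_Cc_Dn_Hh : ∀ (f l m : ℕ) (x : A), N = 2 * f + l → 1 ≤ m → m + N + 1 ≤ n →
    (∀ i ≤ f, D.Ends x (m + 2 * i)) →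
    x * D.Cc (m + 2 * f + 1) (l + 1) * D.Dn m (2 * f) * D.Hh f (m + 1) (N + 1) =
      x * D.Hh f (m + 2) N * D.Cc (m + 1) (N + 1) := by
    intro f l m x hN hm hn hx
    cases f with
    | zero =>
      obtain rfl : N = l := by omega
      simp only [mul_zero, add_zero, Dn_zero, Hh_zero, mul_one]
    | succ f =>
      obtain ⟨M, rfl⟩ : ∃ M, N = M + 2 := ⟨2 * f + l, by omega⟩
      have hM : M = 2 * f + l := by omega
      have hx2 : ∀ i ≤ f, D.Ends x (m + 2 + 2 * i) := fun i hi => by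
        have := hx (i + 1) (by omega)
        rwa [show m + 2 * (i + 1) = m + 2 + 2 * i by omega] at this
      obtain ⟨ih1, ih2⟩ := IH M (by omega) f l (m + 2) x hM (by omega) (by omega) hx2
      have e0 : m + 2 + 2 * f + 1 = m + 2 * f + 3 := by omega
      rw [e0] at ih1
      have hd : D.Dn m (2 * f + 2) = D.Dn (m + 2) (2 * f) * (D.T (m + 1) * D.T m) := by
        rw [Dn_succ', Dn_succ', mul_assoc]
      have hd' : D.Dn m (2 * f + 4) = D.Dn (m + 2) (2 * f + 2) * (D.T (m + 1) * D.T m) := by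
        rw [Dn_succ', Dn_succ', mul_assoc]
      have c1 : Commute (D.T (m + 1) * D.T m) (D.Hh f (m + 3) (M + 1)) :=
        (commute_T_Hh (by omega) (by omega) (by omega) (by omega) (by omega)).mul_left
          (commute_T_Hh (by omega) (by omega) (by omega) (by omega) (by omega))
      have t1 : x * D.Cc (m + 2 * f + 3) (l + 1) * D.Dn m (2 * f + 2) *
          (D.Hh f (m + 3) (M + 1) * D.Cc (m + 2) (M + 2)) =
          x * D.Hh f (m + 4) M * D.Cc (m + 3) (M + 1) * D.T (m + 1) * D.T m *
            D.Cc (m + 2) (M + 2) := by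
        rw [hd]
        calc _ = x * D.Cc (m + 2 * f + 3) (l + 1) * D.Dn (m + 2) (2 * f) *
              ((D.T (m + 1) * D.T m) * D.Hh f (m + 3) (M + 1)) * D.Cc (m + 2) (M + 2) := by
              simp only [mul_assoc]
          _ = (x * D.Cc (m + 2 * f + 3) (l + 1) * D.Dn (m + 2) (2 * f) * D.Hh f (m + 3) (M + 1)) *
              D.T (m + 1) * D.T m * D.Cc (m + 2) (M + 2) := by
              rw [c1.eq]; simp only [mul_assoc]
          _ = _ := by rw [ih1]
      have t2 : x * D.Hh f (m + 4) M * D.Cc (m + 3) (M + 1) * D.T (m + 1) * (D.T m - q • 1) *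
          D.Cc (m + 2) (M + 2) = -(q * (q - q⁻¹)) • (qnum q (f + 1) •
            (x * D.Hh (f + 1) (m + 2) (M + 2))) := by
        rw [← ih2]
        exact Ends.mul_Hh_one ((hx 0 (by omega)).mul_Hh (by omega) (by omega) (by omega) (by omega)
          (by omega)) ((hx 1 (by omega)).mul_Hh (by omega) (by omega) (by omega) (by omega)
          (by omega)) hm (by omega)
      have t3 : x * D.Dn m (2 * f + 2) * D.Dn (m + 1) (2 * f + 2) = x :=
        mul_Dn_mul_Dn (k := f + 1) hx hm (by omega)
      have t4 : x * (D.T (m + 2 * f + 3) * D.Cc (m + 2 * f + 4) l) * D.Dn m (2 * f + 2) *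
          D.Dn (m + 1) (2 * f + 2) * D.Hh (f + 1) (m + 2) (M + 2) =
          x * D.Dn (m + 2) (2 * f + 2) * D.Hh (f + 1) (m + 3) (M + 1) * D.T (m + 1) *
            D.Cc (m + 2) (M + 2) := by
        cases l with
        | zero =>
          rw [Cc_zero, D.Hh_eq_zero (f := f + 1) (k := M + 1) (by omega)]
          simp only [mul_zero, zero_mul]
        | succ l =>
          have hx' : ∀ i ≤ f + 1, D.Ends (x * D.Dn m (2 * f + 4)) (m + 1 + 2 * i) := fun i hi => by
            rw [add_right_comm m 1]
            exact (hx i hi).mul_Dn hm (by omega) (by omega) (by omega)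
          have ih3 := (IH (M + 1) (by omega) (f + 1) l (m + 1) _ (by omega) (by omega) (by omega)
            hx').1
          rw [show m + 1 + 2 * (f + 1) + 1 = m + 2 * f + 4 by omega] at ih3
          refine mul_T_cancel (D := D) hm (by omega) ?_
          have c2 : Commute (D.T m) (D.Hh (f + 1) (m + 2) (M + 2)) :=
            commute_T_Hh (by omega) (by omega) (by omega) (by omega) (by omega)
          have c3 : Commute (D.T m) (D.Cc (m + 2) (M + 2)) :=
            commute_T_Cc (by omega) (by omega) (by omega) (by omega) (by omega)
          have c4 : Commute (D.T (m + 1) * D.T m) (D.Hh (f + 1) (m + 3) (M + 1)) :=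
            (commute_T_Hh (by omega) (by omega) (by omega) (by omega) (by omega)).mul_left
              (commute_T_Hh (by omega) (by omega) (by omega) (by omega) (by omega))
          have c5 : Commute (D.Cc (m + 2 * f + 4) (l + 1)) (D.Dn m (2 * f + 3)) :=
            (commute_Cc fun j hj hj' => (commute_T_Dn (i := j) (by omega) (by omega) (by omega)
              (by omega) (by omega)).symm).symm
          calc _ = x * D.T (m + 2 * f + 3) * D.Cc (m + 2 * f + 4) (l + 1) * D.Dn m (2 * f + 2) *
                D.Dn (m + 1) (2 * f + 2) * (D.Hh (f + 1) (m + 2) (M + 2) * D.T m) := by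
                simp only [mul_assoc]
            _ = x * D.T (m + 2 * f + 3) * D.Cc (m + 2 * f + 4) (l + 1) * (D.Dn m (2 * f + 2) *
                D.Dn m (2 * f + 3)) * D.Hh (f + 1) (m + 2) (M + 2) := by
                rw [← c2.eq, Dn_succ' _ m (2 * f + 2)]; simp only [mul_assoc]
            _ = x * D.T (m + 2 * f + 3) * (D.Cc (m + 2 * f + 4) (l + 1) * D.Dn m (2 * f + 3)) *
                D.Dn (m + 1) (2 * f + 2) * D.Hh (f + 1) (m + 2) (M + 2) := by
                rw [Dn_mul_Dn hm (by omega) (by omega)]; simp only [mul_assoc]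
            _ = x * D.Dn m (2 * f + 4) * D.Cc (m + 2 * f + 4) (l + 1) *
                D.Dn (m + 1) (2 * f + 2) * D.Hh (f + 1) (m + 2) (M + 2) := by
                rw [c5.eq, Dn_succ _ m (2 * f + 3), ← add_assoc]; simp only [mul_assoc]
            _ = x * D.Dn m (2 * f + 4) * D.Hh (f + 1) (m + 3) (M + 1) * D.Cc (m + 2) (M + 2) := ih3
            _ = x * D.Dn (m + 2) (2 * f + 2) * ((D.T (m + 1) * D.T m) *
                D.Hh (f + 1) (m + 3) (M + 1)) * D.Cc (m + 2) (M + 2) := by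
                rw [hd']; simp only [mul_assoc]
            _ = x * D.Dn (m + 2) (2 * f + 2) * D.Hh (f + 1) (m + 3) (M + 1) * D.T (m + 1) *
                (D.T m * D.Cc (m + 2) (M + 2)) := by
                rw [c4.eq]; simp only [mul_assoc]
            _ = _ := by rw [c3.eq]; simp only [mul_assoc]
      have h1 : D.Hh (f + 1) (m + 1) (M + 3) = D.Hh f (m + 3) (M + 1) * D.Cc (m + 2) (M + 2) +
          q ^ (2 * f + 2) • (D.Dn (m + 1) (2 * f + 2) * D.Hh (f + 1) (m + 2) (M + 2)) :=
        D.Hh_succ f (m + 1) (M + 1)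
      have h2 : x * D.Hh (f + 1) (m + 2) (M + 2) * (D.T (m + 1) * D.Cc (m + 2) (M + 2)) =
          x * (D.Hh f (m + 4) M * D.Cc (m + 3) (M + 1) +
          q ^ (2 * f + 2) • (D.Dn (m + 2) (2 * f + 2) * D.Hh (f + 1) (m + 3) (M + 1))) *
          (D.T (m + 1) * D.Cc (m + 2) (M + 2)) := by rw [← D.Hh_succ f (m + 2) M]
      have h3 : x * D.Cc (m + 2 * f + 3) (l + 1) * D.Dn m (2 * f + 2) *
          D.Dn (m + 1) (2 * f + 2) * D.Hh (f + 1) (m + 2) (M + 2) =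
          x * D.Hh (f + 1) (m + 2) (M + 2) +
          q • (x * (D.T (m + 2 * f + 3) * D.Cc (m + 2 * f + 4) l) * D.Dn m (2 * f + 2) *
          D.Dn (m + 1) (2 * f + 2) * D.Hh (f + 1) (m + 2) (M + 2)) := by
        nth_rewrite 2 [← t3]
        rw [Cc_succ]
        simp only [mul_add, add_mul, mul_one, mul_smul_comm, smul_mul_assoc]
      change x * D.Cc (m + 2 * f + 3) (l + 1) * D.Dn m (2 * f + 2) *
        D.Hh (f + 1) (m + 1) (M + 3) =
        x * D.Hh (f + 1) (m + 2) (M + 2) * D.Cc (m + 1) (M + 3)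
      rw [h1, Cc_succ _ (m + 1)]
      simp only [mul_add, add_mul, mul_sub, sub_mul, mul_one, mul_smul_comm, smul_mul_assoc,
        ← mul_assoc] at t1 t2 t3 t4 h2 h3 ⊢
      have hn' : q ^ (2 * f + 2) = q * (q - q⁻¹) * qnum q (f + 1) + 1 := by
        rw [mul_qnum D.hq]; ring
      rw [h2, t1, h3, t4, hn']
      linear_combination (norm := module) t2
  intro f l m x hN hm hn hx
  refine ⟨mul_Cc_Dn_Hh f l m x hN hm hn hx, ?_⟩
  cases f with
  | zero => rw [Hh_zero, mul_one, zero_add, qnum_one, one_smul]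
  | succ f =>
    obtain ⟨M, rfl⟩ : ∃ M, N = M + 2 := ⟨2 * f + l, by omega⟩
    have hM : M = 2 * f + l := by omega
    have hx2 : ∀ i ≤ f, D.Ends x (m + 2 + 2 * i) := fun i hi => by
      have := hx (i + 1) (by omega)
      rwa [show m + 2 * (i + 1) = m + 2 + 2 * i by omega] at this
    have ih2 := (IH M (by omega) f l (m + 2) x hM (by omega) (by omega) hx2).2
    have hd' : D.Dn m (2 * f + 4) = D.Dn (m + 2) (2 * f + 2) * (D.T (m + 1) * D.T m) := by
      rw [Dn_succ', Dn_succ', mul_assoc]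
    have c4 : Commute (D.T (m + 1) * D.T m) (D.Hh (f + 1) (m + 3) (M + 1)) :=
      (commute_T_Hh (by omega) (by omega) (by omega) (by omega) (by omega)).mul_left
        (commute_T_Hh (by omega) (by omega) (by omega) (by omega) (by omega))
    have t1 : x * D.Dn m (2 * f + 4) * D.Hh (f + 1) (m + 3) (M + 1) * D.Hh 1 (m + 1) (M + 3) =
        qnum q (f + 2) • (x * D.Dn m (2 * f + 4) * D.Hh (f + 2) (m + 1) (M + 3)) := by
      cases l with
      | zero =>
        rw [D.Hh_eq_zero (f := f + 1) (k := M + 1) (by omega),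
          D.Hh_eq_zero (f := f + 2) (k := M + 3) (by omega)]
        simp only [mul_zero, zero_mul, smul_zero]
      | succ l =>
        have hx' : ∀ i ≤ f + 1, D.Ends (x * D.Dn m (2 * f + 4)) (m + 1 + 2 * i) := fun i hi => by
          rw [add_right_comm m 1]
          exact (hx i hi).mul_Dn hm (by omega) (by omega) (by omega)
        exact (IH (M + 1) (by omega) (f + 1) l (m + 1) _ (by omega) (by omega) (by omega) hx').2
    have t2 : x * D.Hh f (m + 4) M * D.Cc (m + 3) (M + 1) * (D.T (m + 1) * D.T m) *
        D.Hh 1 (m + 1) (M + 3) = qnum q (f + 1) • (x * D.Hh (f + 1) (m + 2) (M + 2) *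
          D.Cc (m + 1) (M + 3)) := by
      have hy : ∀ i ≤ 1, D.Ends (x * D.Hh f (m + 4) M) (m + 2 * i) := fun i hi =>
        (hx i (by omega)).mul_Hh (by omega) (by omega) (by omega) (by omega) (by omega)
      have := mul_Cc_Dn_Hh 1 M m _ (by omega) hm (by omega) hy
      change x * D.Hh f (m + 4) M * D.Cc (m + 3) (M + 1) * D.Dn m 2 *
        D.Hh 1 (m + 1) (M + 3) = x * D.Hh f (m + 4) M * D.Hh 1 (m + 2) (M + 2) *
          D.Cc (m + 1) (M + 3) at this
      rw [ih2, Dn_succ, Dn_succ, Dn_zero, mul_one, add_zero, smul_mul_assoc] at this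
      exact this
    have h1 : D.Hh (f + 2) m (M + 4) = D.Hh (f + 1) (m + 2) (M + 2) * D.Cc (m + 1) (M + 3) +
          q ^ (2 * f + 4) • (D.Dn m (2 * f + 4) * D.Hh (f + 2) (m + 1) (M + 3)) :=
        D.Hh_succ (f + 1) m (M + 2)
    have h2 : D.Hh 1 m (M + 4) = D.Cc (m + 1) (M + 3) +
        q ^ 2 • (D.T (m + 1) * D.T m * D.Hh 1 (m + 1) (M + 3)) := D.Hh_one_succ m (M + 2)
    have h3 : x * D.Hh (f + 1) (m + 2) (M + 2) * (D.T (m + 1) * D.T m * D.Hh 1 (m + 1) (M + 3)) =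
        x * D.Hh f (m + 4) M * D.Cc (m + 3) (M + 1) * (D.T (m + 1) * D.T m) *
          D.Hh 1 (m + 1) (M + 3) +
        q ^ (2 * f + 2) • (x * D.Dn m (2 * f + 4) * D.Hh (f + 1) (m + 3) (M + 1) *
          D.Hh 1 (m + 1) (M + 3)) := by
      rw [D.Hh_succ f (m + 2) M, hd', mul_assoc x (_ * _) (D.Hh (f + 1) (m + 3) (M + 1)),
        mul_assoc (D.Dn (m + 2) (2 * f + 2)), c4.eq]
      simp only [mul_add, add_mul, mul_smul_comm, smul_mul_assoc, mul_assoc]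
    change x * D.Hh (f + 1) (m + 2) (M + 2) * D.Hh 1 m (M + 4) =
      qnum q (f + 2) • (x * D.Hh (f + 2) m (M + 4))
    rw [h2, mul_add, mul_smul_comm, h3, t1, t2, h1, qnum_succ' q (f + 1)]
    simp only [mul_add, mul_smul_comm, ← mul_assoc]
    module

/-- Multiplying the sum over `H_f` by the sum over `H_1` of the remaining points. -/
theorem mul_Hh_mul_Hh_one {f l m : ℕ} {x : A} (hm : 1 ≤ m) (hn : m + 2 * f + l + 1 ≤ n)
    (hx : ∀ i ≤ f, D.Ends x (m + 2 * i)) :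
    x * D.Hh f (m + 2) (2 * f + l) * D.Hh 1 m (2 * f + l + 2) =
      qnum q (f + 1) • (x * D.Hh (f + 1) m (2 * f + l + 2)) :=
  (mul_Cc_Dn_Hh_and_mul_Hh_Hh_one (2 * f + l) f l m x rfl hm (by omega) hx).2

theorem mul_Cc_mul_Dn_mul_Hh {f l m : ℕ} {x : A} (hm : 1 ≤ m) (hn : m + 2 * f + l + 1 ≤ n)
    (hx : ∀ i ≤ f, D.Ends x (m + 2 * i)) :
    x * D.Cc (m + 2 * f + 1) (l + 1) * D.Dn m (2 * f) * D.Hh f (m + 1) (2 * f + l + 1) =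
      x * D.Hh f (m + 2) (2 * f + l) * D.Cc (m + 1) (2 * f + l + 1) :=
  (mul_Cc_Dn_Hh_and_mul_Hh_Hh_one (2 * f + l) f l m x rfl hm (by omega) hx).1

/-- As `mul_Hh_mul_Hh_one`, with the additional pair of points picked first. -/
theorem mul_Hh_one_mul_Hh (f : ℕ) : ∀ (l m : ℕ) (x : A), 1 ≤ m → m + 2 * f + l + 1 ≤ n →
    (∀ i ≤ f, D.Ends x (m + 2 * i)) →
    x * D.Hh 1 (m + 2 * f) (l + 2) * D.Hh f m (2 * f + l + 2) =
      qnum q (f + 1) • (x * D.Hh (f + 1) m (2 * f + l + 2)) := by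
  induction f with
  | zero =>
    intro l m x _ _ _
    simp only [Hh_zero, mul_one, mul_zero, add_zero, zero_add, qnum_one, one_smul]
  | succ f ihf =>
    intro l
    induction l using Nat.strong_induction_on with
    | _ l ihl =>
    intro m x hm hn hx
    have hx2 : ∀ i ≤ f, D.Ends x (m + 2 + 2 * i) := fun i hi => by
      have := hx (i + 1) (by omega)
      rwa [show m + 2 * (i + 1) = m + 2 + 2 * i by omega] at this
    have t1 := ihf l (m + 2) x (by omega) (by omega) hx2
    have t2 := mul_Cc_mul_Dn_mul_Hh (f := f + 1) hm hn hx
    have t3 : x * D.Dn m (2 * f + 4) * D.Hh 1 (m + 2 * f + 3) (l + 1) *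
        D.Hh (f + 1) (m + 1) (2 * f + l + 3) =
        qnum q (f + 2) • (x * D.Dn m (2 * f + 4) * D.Hh (f + 2) (m + 1) (2 * f + l + 3)) := by
      cases l with
      | zero =>
        rw [Hh_one_one, D.Hh_eq_zero (f := f + 2) (by omega)]
        simp only [mul_zero, zero_mul, smul_zero]
      | succ l =>
        have hx' : ∀ i ≤ f + 1, D.Ends (x * D.Dn m (2 * f + 4)) (m + 1 + 2 * i) := fun i hi => by
          rw [add_right_comm m 1]
          exact (hx i hi).mul_Dn hm (by omega) (by omega) (by omega)
        have := ihl l (by omega) (m + 1) _ (by omega) (by omega) hx'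
        rwa [show m + 1 + 2 * (f + 1) = m + 2 * f + 3 by omega,
          show 2 * (f + 1) + l + 2 = 2 * f + (l + 1) + 3 by omega] at this
    have c1 : Commute (D.Hh 1 (m + 2 * f + 3) (l + 1)) (D.Dn m (2 * f + 2)) :=
      (commute_Hh fun j hj hj' => (commute_T_Dn (i := j) (by omega) (by omega) (by omega)
        (by omega) (by omega)).symm).symm
    have t4 : x * (D.T (m + 2 * f + 3) * D.T (m + 2 * f + 2) * D.Hh 1 (m + 2 * f + 3) (l + 1)) *
        D.Dn m (2 * f + 2) =
        x * D.Dn m (2 * f + 4) * D.Hh 1 (m + 2 * f + 3) (l + 1) := by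
      rw [mul_assoc, mul_assoc (_ * _), c1.eq, Dn_succ _ m (2 * f + 3), Dn_succ _ m (2 * f + 2)]
      simp only [mul_assoc, add_assoc]
    rw [show m + 2 + 2 * f = m + 2 * f + 2 by omega] at t1
    rw [show m + 2 * (f + 1) = m + 2 * f + 2 by omega,
      show 2 * (f + 1) + l = 2 * f + l + 2 by omega] at t2
    rw [show m + 2 * (f + 1) = m + 2 * f + 2 by omega,
      show 2 * (f + 1) + l + 2 = 2 * f + l + 2 + 2 by omega, D.Hh_succ (f + 1) m]
    conv_lhs => arg 2; rw [Hh_succ]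
    rw [mul_add, ← mul_assoc, t1, mul_smul_comm]
    have t5 : x * D.Hh 1 (m + 2 * f + 2) (l + 2) * (D.Dn m (2 * f + 2) *
        D.Hh (f + 1) (m + 1) (2 * f + l + 2 + 1)) =
        x * D.Hh (f + 1) (m + 2) (2 * f + l + 2) * D.Cc (m + 1) (2 * f + l + 2 + 1) +
        (q ^ 2 * qnum q (f + 2)) • (x * D.Dn m (2 * f + 4) *
          D.Hh (f + 2) (m + 1) (2 * f + l + 3)) := by
      have t6 : x * D.Hh 1 (m + 2 * f + 2) (l + 2) * D.Dn m (2 * f + 2) =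
          x * D.Cc (m + 2 * f + 3) (l + 1) * D.Dn m (2 * f + 2) +
          q ^ 2 • (x * D.Dn m (2 * f + 4) * D.Hh 1 (m + 2 * f + 3) (l + 1)) := by
        rw [Hh_one_succ, mul_add, mul_smul_comm, add_mul, smul_mul_assoc]
        exact congrArg (_ + q ^ 2 • ·) t4
      rw [← mul_assoc, t6, ← t2, mul_smul, ← t3, add_mul, smul_mul_assoc]
      rfl
    rw [t5, qnum_succ q (f + 1)]
    simp only [mul_add, mul_smul_comm, smul_mul_assoc, ← mul_assoc]
    module

end BMWData

namespace BMWData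

variable {F : Type*} [Field F] {A : Type*} [Ring A] [Algebra F A] {n : ℕ} {q r : F}
variable (D : BMWData F A n q r)

/-- The defect of `v` from being an eigenvector of right multiplication by `T i`. -/
def defect (v : A) (i : ℕ) : A := v * D.T i - q • v

/-- The defects of `v` at `i + 1` and at `i` are related by `E (i + 1)`. -/
def Linked (v : A) (i : ℕ) : Prop := D.defect v (i + 1) = D.defect v i * D.E (i + 1)

/-- The defects of `v` at the generators on the points `m, …, m + k - 1` are all determined
by the first one, which is a left multiple of `E m`. -/
def Good (v : A) (m k : ℕ) : Prop :=
  (2 ≤ k → D.Ends (D.defect v m) m) ∧ ∀ i, m ≤ i → i + 2 < m + k → D.Linked v i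

theorem defect_add (v w : A) (i : ℕ) : D.defect (v + w) i = D.defect v i + D.defect w i := by
  simp only [defect, add_mul, smul_add]; abel

theorem defect_smul (c : F) (v : A) (i : ℕ) : D.defect (c • v) i = c • D.defect v i := by
  simp only [defect, smul_mul_assoc, smul_sub]; module

theorem defect_mul (x v : A) (i : ℕ) : D.defect (x * v) i = x * D.defect v i := by
  simp only [defect, mul_sub, mul_smul_comm, mul_assoc]

theorem defect_eq (v : A) (i : ℕ) : D.defect v i = v * (D.T i - q • 1) := by
  simp only [defect, mul_sub, mul_smul_comm, mul_one]

variable {D}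

/-- If `T j * y = y * T i`, the defect of `v * y` at `i` comes from that of `v` at `j`. -/
theorem defect_mul_of_mul_T {y : A} {i j : ℕ} (h : y * D.T i = D.T j * y) (v : A) :
    D.defect (v * y) i = D.defect v j * y := by
  simp only [defect, sub_mul, smul_mul_assoc, mul_assoc, h]

theorem Ends.add {x y : A} {i : ℕ} (hx : D.Ends x i) (hy : D.Ends y i) : D.Ends (x + y) i := by
  obtain ⟨w, rfl⟩ := hx
  obtain ⟨w', rfl⟩ := hy
  exact ⟨w + w', (add_mul _ _ _).symm⟩

theorem Ends.smul {x : A} {i : ℕ} (c : F) (hx : D.Ends x i) : D.Ends (c • x) i := by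
  obtain ⟨w, rfl⟩ := hx
  exact ⟨c • w, (smul_mul_assoc _ _ _).symm⟩

theorem Ends.zero (i : ℕ) : D.Ends 0 i := ⟨0, (zero_mul _).symm⟩

theorem Ends.mul_left {y : A} {i : ℕ} (x : A) (hy : D.Ends y i) : D.Ends (x * y) i := by
  obtain ⟨w, rfl⟩ := hy
  exact ⟨x * w, (mul_assoc _ _ _).symm⟩

theorem Linked.add {v w : A} {i : ℕ} (hv : D.Linked v i) (hw : D.Linked w i) :
    D.Linked (v + w) i := by
  simp only [Linked, defect_add, add_mul] at *
  rw [hv, hw]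

theorem Linked.smul {v : A} {i : ℕ} (c : F) (hv : D.Linked v i) : D.Linked (c • v) i := by
  simp only [Linked, defect_smul, smul_mul_assoc] at *
  rw [hv]

theorem Linked.mul_left {v : A} {i : ℕ} (x : A) (hv : D.Linked v i) : D.Linked (x * v) i := by
  simp only [Linked, defect_mul, mul_assoc] at *
  rw [hv]

theorem Linked.zero (i : ℕ) : D.Linked 0 i := by
  simp only [Linked, defect, zero_mul, smul_zero, sub_zero]

theorem Good.add {v w : A} {m k : ℕ} (hv : D.Good v m k) (hw : D.Good w m k) :
    D.Good (v + w) m k :=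
  ⟨fun hk => by rw [defect_add]; exact (hv.1 hk).add (hw.1 hk),
    fun i hi hik => (hv.2 i hi hik).add (hw.2 i hi hik)⟩

theorem Good.smul {v : A} {m k : ℕ} (c : F) (hv : D.Good v m k) : D.Good (c • v) m k :=
  ⟨fun hk => by rw [defect_smul]; exact (hv.1 hk).smul c,
    fun i hi hik => (hv.2 i hi hik).smul c⟩

theorem Good.sum {ι : Type*} {s : Finset ι} {v : ι → A} {m k : ℕ}
    (h : ∀ i ∈ s, D.Good (v i) m k) : D.Good (∑ i ∈ s, v i) m k := by
  refine sum_induction v (D.Good · m k) (fun _ _ hv hw => hv.add hw)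
    ⟨fun _ => ?_, fun i _ _ => Linked.zero i⟩ h
  rw [defect, zero_mul, smul_zero, sub_zero]
  exact Ends.zero m

theorem Good.mul_left {v : A} {m k : ℕ} (x : A) (h : D.Good v m k) : D.Good (x * v) m k :=
  ⟨fun hk => by rw [defect_mul]; exact (h.1 hk).mul_left x,
    fun i hi hik => (h.2 i hi hik).mul_left x⟩

theorem Good.mul_right {v y : A} {m k : ℕ} (h : D.Good v m k) (hm : 1 ≤ m) (hk : m + k ≤ n + 1)
    (hy : ∀ j, m ≤ j → j + 1 < m + k → Commute y (D.T j)) : D.Good (v * y) m k := by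
  refine ⟨fun hk => ?_, fun i hi hik => ?_⟩
  · have c := hy m le_rfl (by omega)
    rw [defect_mul_of_mul_T c.eq]
    exact (h.1 hk).mul_of_commute (D.commute_E_of_commute_T hm (by omega) c)
  · have c := hy (i + 1) (by omega) (by omega)
    rw [Linked, defect_mul_of_mul_T c.eq, defect_mul_of_mul_T (hy i (by omega) (by omega)).eq,
      h.2 i hi hik, mul_assoc, mul_assoc, (D.commute_E_of_commute_T (by omega) (by omega) c).eq]

theorem Good.ends {v : A} {m k : ℕ} (h : D.Good v m k) {i : ℕ} (hi : m ≤ i) (hik : i + 1 < m + k) :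
    D.Ends (D.defect v i) i := by
  rcases Nat.eq_or_lt_of_le hi with rfl | hi
  · exact h.1 (by omega)
  · obtain ⟨i, rfl⟩ : ∃ j, i = j + 1 := ⟨i - 1, by omega⟩
    exact ⟨_, h.2 i (by omega) (by omega)⟩

theorem Good.tail {v : A} {m k : ℕ} (h : D.Good v m (k + 1)) : D.Good v (m + 1) k :=
  ⟨fun hk => h.ends (by omega) (by omega), fun i hi hik => h.2 i (by omega) (by omega)⟩

theorem linked_of_ends {v : A} {i : ℕ} (hi : 1 ≤ i) (hin : i + 1 < n)
    (h : D.Ends (D.defect v (i + 1)) (i + 1)) :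
    D.Linked (v * (1 + q • D.T i + q ^ 2 • (D.T i * D.T (i + 1)))) i := by
  obtain ⟨t, ht⟩ := h
  have e1 : v * D.T (i + 1) = q • v + t * D.E (i + 1) := by
    rw [← ht, defect]; abel
  have e2 : v * D.E i * D.E (i + 1) = q • (v * D.T i * D.E (i + 1)) + r • (t * D.E (i + 1)) := by
    rw [mul_assoc, ← D.TTE₂ i hi (by omega), ← mul_assoc, ← mul_assoc, e1, add_mul, add_mul,
      mul_assoc t, mul_assoc t, D.ETE₂ i hi (by omega), smul_mul_assoc, smul_mul_assoc,
      mul_smul_comm]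
  have e3 : v * D.T i * D.T (i + 1) * D.T i * D.E (i + 1) =
      r⁻¹ • (v * D.E i * D.E (i + 1)) := by
    rw [mul_assoc, mul_assoc, ← mul_assoc (D.T (i + 1)), D.TTE₂ i hi (by omega), ← mul_assoc,
      mul_assoc v, D.TE i hi (by omega), mul_smul_comm, smul_mul_assoc]
  have e4 : v * D.T i * D.T i * D.E (i + 1) = v * D.E (i + 1) +
      (q - q⁻¹) • (v * D.T i * D.E (i + 1)) -
      ((q - q⁻¹) * r⁻¹) • (v * D.E i * D.E (i + 1)) := by
    rw [mul_assoc v, D.T_sq hi (by omega)]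
    simp only [mul_add, add_mul, mul_sub, sub_mul, mul_one, mul_smul_comm, smul_mul_assoc]
  have e5 : v * D.T i * D.T (i + 1) * D.T (i + 1) = v * D.T i + (q - q⁻¹) • (v * D.T i *
      D.T (i + 1)) - ((q - q⁻¹) * r⁻¹) • (v * D.T i * D.E (i + 1)) := by
    rw [mul_assoc, D.T_sq (by omega) hin]
    simp only [mul_add, mul_sub, mul_one, mul_smul_comm]
  have e6 : v * D.T i * D.T (i + 1) * D.E (i + 1) = r⁻¹ • (v * D.T i * D.E (i + 1)) := by
    rw [mul_assoc, D.TE (i + 1) (by omega) (by omega), mul_smul_comm]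
  simp only [Linked, defect, mul_add, add_mul, sub_mul, mul_one, mul_smul_comm, smul_mul_assoc,
    ← mul_assoc, e1, e3, e4, e5, e6, e2, smul_add, smul_sub]
  have := D.hq
  have := D.hr
  match_scalars <;> field_simp <;> ring

theorem T_mul_T_mul_T_slide {i : ℕ} (hi : 1 ≤ i) (hin : i + 2 < n) :
    D.T i * D.T (i + 1) * D.T (i + 2) * D.T (i + 1) =
      D.T (i + 2) * (D.T i * D.T (i + 1) * D.T (i + 2)) := by
  have h := D.braid (i + 1) (by omega) (by omega)
  have c := (D.commute_T_T (i := i) (j := i + 2) hi (by omega) (by omega) (by omega) (by omega)).eq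
  calc _ = D.T i * (D.T (i + 1) * D.T (i + 2) * D.T (i + 1)) := by simp only [mul_assoc]
    _ = (D.T i * D.T (i + 2)) * D.T (i + 1) * D.T (i + 2) := by rw [h]; simp only [mul_assoc]
    _ = _ := by rw [c]; simp only [mul_assoc]

theorem Good.mul_Cc {k : ℕ} : ∀ {m : ℕ} {v : A}, D.Good v (m + 1) k → 1 ≤ m → m + k ≤ n →
    D.Good (v * D.Cc m (k + 1)) m (k + 1) := by
  induction k with
  | zero => exact fun h hm hk => ⟨fun h => by omega, fun i hi h => by omega⟩
  | succ k ih =>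
    intro m v h hm hk
    refine ⟨fun _ => ?_, fun i hi hik => ?_⟩
    · have c : Commute (D.T m) (D.Cc (m + 2) k) :=
        commute_T_Cc hm (by omega) (by omega) (by omega) (by omega)
      have e : v * D.Cc m (k + 1 + 1) = v * (1 + q • D.T m) +
          q ^ 2 • (v * (D.T m * D.T (m + 1)) * D.Cc (m + 2) k) := by
        rw [Cc_succ, Cc_succ]
        simp only [mul_add, mul_one, mul_smul_comm, smul_add, ← mul_assoc]
        module
      rw [e, defect_add, defect_smul, defect_mul_of_mul_T c.symm.eq, defect_eq, mul_assoc,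
        one_add_mul_sub hm (by omega)]
      refine Ends.add ⟨_, (mul_smul_comm _ _ _).trans (smul_mul_assoc _ _ _).symm⟩ (Ends.smul _ ?_)
      cases k with
      | zero => rw [Cc_zero, mul_zero]; exact Ends.zero m
      | succ k =>
      obtain ⟨t, ht⟩ := h.1 (by omega)
      rw [defect_mul_of_mul_T (braid_shift hm (by omega)), ht, mul_assoc t, ← mul_assoc (D.E _),
        D.E_succ_mul_T_mul_T hm (by omega)]
      exact Ends.mul_of_commute ⟨t * D.E (m + 1), (mul_assoc _ _ _).symm⟩
        (D.commute_E_of_commute_T hm (by omega) c.symm)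
    · rcases Nat.eq_or_lt_of_le hi with rfl | hi
      · obtain ⟨k, rfl⟩ : ∃ j, k = j + 1 := ⟨k - 1, by omega⟩
        have c0 : Commute (D.T m) (D.Cc (m + 3) k) :=
          commute_T_Cc hm (by omega) (by omega) (by omega) (by omega)
        have c1 : Commute (D.T (m + 1)) (D.Cc (m + 3) k) :=
          commute_T_Cc (by omega) (by omega) (by omega) (by omega) (by omega)
        have e : v * D.Cc m (k + 1 + 1 + 1) =
            v * (1 + q • D.T m + q ^ 2 • (D.T m * D.T (m + 1))) +
            q ^ 3 • (v * (D.T m * D.T (m + 1) * D.T (m + 2)) * D.Cc (m + 3) k) := by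
          rw [Cc_succ, Cc_succ, Cc_succ]
          simp only [mul_add, mul_one, mul_smul_comm, smul_add, ← mul_assoc]
          module
        rw [e]
        refine (linked_of_ends hm (by omega) (h.1 (by omega))).add (Linked.smul _ ?_)
        cases k with
        | zero => rw [Cc_zero, mul_zero]; exact Linked.zero m
        | succ k =>
        have s1 := T_mul_T_mul_T_slide (D := D) hm (by omega)
        have s0 : D.T m * D.T (m + 1) * D.T (m + 2) * D.T m =
            D.T (m + 1) * (D.T m * D.T (m + 1) * D.T (m + 2)) := by
          have := D.braid m hm (by omega)
          rw [mul_assoc _ (D.T (m + 2)), ← (D.commute_T_T hm (by omega) (by omega) (by omega)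
            (by omega)).eq, ← mul_assoc, this]
          simp only [mul_assoc]
        rw [Linked, defect_mul_of_mul_T c1.symm.eq, defect_mul_of_mul_T c0.symm.eq,
          defect_mul_of_mul_T s1, defect_mul_of_mul_T s0, h.2 (m + 1) le_rfl (by omega),
          mul_assoc _ (D.Cc _ _) (D.E _), (D.commute_E_of_commute_T (by omega) (by omega)
            c1.symm).eq]
        have s2 := congrArg (D.defect v (m + 1) * · * D.Cc (m + 3) (k + 1))
          (D.mul_E_of_mul_T (by omega) (by omega) (by omega) (by omega) s1)
        simp only [mul_assoc] at s2 ⊢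
        exact s2.symm
      · have h' := ih (m := m + 1) (v := v * D.T m) (h.tail.mul_right (by omega) (by omega)
          fun j hj hj' => D.commute_T_T hm (by omega) (by omega) (by omega) (by omega))
          (by omega) (by omega)
        rw [Cc_succ, mul_add, mul_one, mul_smul_comm, ← mul_assoc]
        exact (h.2 i (by omega) (by omega)).add (Linked.smul q (h'.2 i (by omega) (by omega)))

theorem Good.mul_Cc_eq {k : ℕ} : ∀ {m : ℕ} {v : A}, D.Good v m k → 1 ≤ m → m + k ≤ n + 1 →
    v * D.Cc m k = qnum q k • v + q • (D.defect v m * D.Hh 1 m k) := by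
  induction k with
  | zero => intro m v _ _ _; simp [Cc_zero, Hh_one_zero, qnum_zero]
  | succ k ih =>
    intro m v h hm hk
    cases k with
    | zero => simp [Cc_one, Hh_one_one, qnum_one]
    | succ k =>
    have e1 : v * D.T m = q • v + D.defect v m := by rw [defect]; abel
    have e2 : D.defect v (m + 1) * D.Hh 1 (m + 1) (k + 1) =
        D.defect v m * (D.T (m + 1) * D.T m * D.Hh 1 (m + 1) (k + 1)) := by
      cases k with
      | zero => simp only [zero_add, Hh_one_one, mul_zero]
      | succ k =>
      rw [h.2 m le_rfl (by omega), ← (h.1 (by omega)).mul_T_mul_T hm (by omega)]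
      simp only [mul_assoc]
    have e3 := ih h.tail (by omega) (by omega)
    rw [Cc_succ, mul_add, mul_one, mul_smul_comm, ← mul_assoc, e1, add_mul, smul_mul_assoc, e3, e2,
      Hh_one_succ, qnum_succ' q (k + 1), mul_add, mul_smul_comm]
    module

theorem T_mul_swap {i : ℕ} (hi : 1 ≤ i) (hin : i + 2 < n) :
    D.T (i + 1) * D.T i * D.T (i + 2) * D.T (i + 1) * D.T i =
      D.T (i + 2) * (D.T (i + 1) * D.T i * D.T (i + 2) * D.T (i + 1)) := by
  have h := D.braid i hi (by omega)
  have h' := D.braid (i + 1) (by omega) (by omega)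
  have c := (D.commute_T_T (i := i) (j := i + 2) hi (by omega) (by omega) (by omega) (by omega)).eq
  calc _ = D.T (i + 1) * (D.T i * D.T (i + 2)) * D.T (i + 1) * D.T i := by simp only [mul_assoc]
    _ = D.T (i + 1) * D.T (i + 2) * (D.T i * D.T (i + 1) * D.T i) := by
        rw [c]; simp only [mul_assoc]
    _ = (D.T (i + 1) * D.T (i + 1 + 1) * D.T (i + 1)) * D.T i * D.T (i + 1) := by
        rw [h]; simp only [mul_assoc]
    _ = D.T (i + 2) * D.T (i + 1) * (D.T (i + 2) * D.T i) * D.T (i + 1) := by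
        rw [h']; simp only [mul_assoc]
    _ = _ := by rw [← c]; simp only [mul_assoc]

theorem Ends.defect_self {v : A} {m : ℕ} (h : D.Ends v m) (hm : 1 ≤ m) (hn : m < n) :
    D.defect v m = (r⁻¹ - q) • v := by
  rw [defect, h.mul_T hm hn]; module

theorem Ends.mul_E_mul_T {v : A} {m : ℕ} (h : D.Ends v m) (hm : 1 ≤ m) (hn : m + 1 < n) :
    v * D.E (m + 1) * D.T m =
      v * D.T (m + 1) + (q - q⁻¹) • (v * D.E (m + 1)) - (q - q⁻¹) • v := by
  rw [← h.mul_T_mul_T hm hn, mul_assoc (v * D.T (m + 1)), D.T_sq (by omega) (by omega)]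
  simp only [mul_add, mul_sub, mul_one, mul_smul_comm, h.mul_T_mul_E hm hn, h.mul_T_mul_T hm hn]
  have := D.hr
  match_scalars <;> field_simp

theorem Ends.linked {v : A} {m : ℕ} (h : D.Ends v m) (hm : 1 ≤ m) (hn : m + 1 < n) :
    D.Linked (v * (1 + q • D.T (m + 1) + q ^ 2 • (D.T (m + 1) * D.T m))) m := by
  have e1 := h.mul_T hm (by omega)
  have e2 := h.mul_T_mul_T hm hn
  have e3 := h.mul_E_mul_T hm hn
  have e4 : v * D.T (m + 1) * D.T (m + 1) = v + (q - q⁻¹) • (v * D.T (m + 1)) -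
      ((q - q⁻¹) * r⁻¹) • (v * D.E (m + 1)) := by
    rw [mul_assoc, D.T_sq (by omega) hn]
    simp only [mul_add, mul_sub, mul_one, mul_smul_comm]
  have e5 : v * D.E (m + 1) * D.T (m + 1) = r⁻¹ • (v * D.E (m + 1)) := by
    rw [mul_assoc, D.ET (m + 1) (by omega) (by omega), mul_smul_comm]
  have e6 : v * D.E (m + 1) * D.E (m + 1) =
      (1 + (r - r⁻¹) / (q - q⁻¹)) • (v * D.E (m + 1)) := by
    rw [mul_assoc, D.Esq (m + 1) (by omega) (by omega), mul_smul_comm]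
  have e7 : v * D.T (m + 1) * D.E (m + 1) = r⁻¹ • (v * D.E (m + 1)) := by
    rw [mul_assoc, D.TE (m + 1) (by omega) (by omega), mul_smul_comm]
  simp only [Linked, defect, mul_add, add_mul, sub_mul, mul_one, mul_smul_comm, smul_mul_assoc,
    ← mul_assoc, e1, e2, e3, e4, e5, e6, e7, smul_add, smul_sub]
  have := D.hq
  have := D.hr
  have := D.hqq
  match_scalars <;> field_simp <;> ring

theorem Hh_one_eq_zero {m k : ℕ} (hk : k < 2) : D.Hh 1 m k = 0 := D.Hh_eq_zero hk

theorem Ends.defect_mul_Hh_one {m k : ℕ} {v : A} (hv : D.Ends v m) (hm : 1 ≤ m) (hk : m + k + 1 ≤ n) :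
    D.defect (v * D.Hh 1 m (k + 2)) m = (r⁻¹ - q) • v -
      (q ^ 2 * (q - q⁻¹)) • (v * D.Cc (m + 2) k) +
      q ^ 4 • (D.defect v (m + 2) * (D.T (m + 1) * D.T m * D.T (m + 2) * D.T (m + 1)) *
        D.Hh 1 (m + 2) k) := by
  cases k with
  | zero => rw [Hh_one_two, Cc_zero, Hh_one_zero, mul_one, hv.defect_self hm (by omega)]; simp
  | succ k =>
  have c0 : Commute (D.T m) (D.Cc (m + 2) (k + 1)) :=
    commute_T_Cc hm (by omega) (by omega) (by omega) (by omega)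
  have e1 : D.defect (v * D.T (m + 1) * (1 + q • D.T m)) m = -(q * (q - q⁻¹)) • v := by
    rw [defect_eq, mul_assoc, one_add_mul_sub hm (by omega), mul_smul_comm,
      hv.mul_T_mul_E hm (by omega), smul_smul, neg_mul, inv_mul_cancel_right₀ D.hr]
  have e2 : D.defect (v * (D.T (m + 1) * D.T m * D.T (m + 2) * D.T (m + 1)) *
      D.Hh 1 (m + 2) (k + 1)) m = D.defect v (m + 2) *
      (D.T (m + 1) * D.T m * D.T (m + 2) * D.T (m + 1)) * D.Hh 1 (m + 2) (k + 1) := by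
    cases k with
    | zero =>
      rw [zero_add, Hh_one_one, mul_zero, mul_zero, defect, zero_mul, smul_zero, sub_zero]
    | succ k =>
      rw [defect_mul_of_mul_T (commute_T_Hh hm (by omega) (by omega) (by omega) (by omega)).symm.eq,
        defect_mul_of_mul_T (T_mul_swap hm (by omega))]
  rw [Hh_one_expand, mul_add, mul_add, mul_one, mul_smul_comm, mul_smul_comm, ← mul_assoc,
    ← mul_assoc, ← mul_assoc, defect_add, defect_add, defect_smul, defect_smul, e2,
    defect_mul_of_mul_T c0.symm.eq, e1, hv.defect_self hm (by omega), smul_mul_assoc]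
  module

theorem Good.mul_Hh_one {k : ℕ} : ∀ {m : ℕ} {v : A}, D.Good v (m + 2) k → D.Ends v m → 1 ≤ m →
    m + k + 1 ≤ n → D.Good (v * D.Hh 1 m (k + 2)) m (k + 2) := by
  induction k with
  | zero =>
    intro m v h hv hm hk
    rw [Hh_one_two, mul_one]
    exact ⟨fun _ => by rw [hv.defect_self hm (by omega)]; exact hv.smul _,
      fun i hi h => by omega⟩
  | succ k ih =>
    intro m v h hv hm hk
    refine ⟨fun _ => ?_, fun i hi hik => ?_⟩
    · rw [hv.defect_mul_Hh_one hm hk, sub_eq_add_neg, ← neg_smul]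
      refine ((hv.smul _).add (Ends.smul _ (hv.mul_of_commute (D.commute_E_of_commute_T hm
        (by omega) (commute_T_Cc hm (by omega) (by omega) (by omega) (by omega)).symm)))).add
        (Ends.smul _ ?_)
      cases k with
      | zero => rw [zero_add, Hh_one_one, mul_zero]; exact Ends.zero m
      | succ k =>
      obtain ⟨t, ht⟩ := h.1 (by omega)
      rw [ht, mul_assoc t, ← D.mul_E_of_mul_T hm (by omega) (by omega) (by omega)
        (T_mul_swap hm (by omega)), ← mul_assoc t]
      exact Ends.mul_Hh ⟨_, rfl⟩ hm (by omega) (by omega) (by omega) (by omega)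
    · rcases Nat.eq_or_lt_of_le hi with rfl | hi
      · have c0 : Commute (D.T m) (D.Cc (m + 3) k) :=
          commute_T_Cc hm (by omega) (by omega) (by omega) (by omega)
        have c1 : Commute (D.T (m + 1)) (D.Cc (m + 3) k) :=
          commute_T_Cc (by omega) (by omega) (by omega) (by omega) (by omega)
        have e : v * D.Hh 1 m (k + 3) =
            v * (1 + q • D.T (m + 1) + q ^ 2 • (D.T (m + 1) * D.T m)) +
            q ^ 2 • (v * (D.T (m + 1) * D.T (m + 2)) * D.Cc (m + 3) k *
              (1 + q • D.T m + q ^ 2 • (D.T m * D.T (m + 1)))) +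
            q ^ 6 • (v * (D.T (m + 1) * D.T m * D.T (m + 2) * D.T (m + 1) * D.T (m + 3) *
              D.T (m + 2)) * D.Hh 1 (m + 3) k) := by
          rw [Hh_one_succ, Hh_one_expand, Cc_succ, Cc_succ]
          cases k with
          | zero =>
            simp only [Cc_zero, Hh_one_zero, mul_add, mul_one, mul_smul_comm, mul_zero, smul_zero,
              zero_mul, smul_add, ← mul_assoc]
            module
          | succ k =>
          have c2 : D.T m * D.T (m + 2) = D.T (m + 2) * D.T m :=
            (D.commute_T_T hm (by omega) (by omega) (by omega) (by omega)).eq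
          have f1 : v * D.T (m + 1) * D.T (m + 2) * D.Cc (m + 3) (k + 1) * D.T m =
              v * D.T (m + 1) * D.T m * D.T (m + 2) * D.Cc (m + 3) (k + 1) := by
            simp only [mul_assoc, ← c0.eq]
            simp only [← mul_assoc, c2]
          have f2 : v * D.T (m + 1) * D.T m * D.T (m + 2) * D.Cc (m + 3) (k + 1) * D.T (m + 1) =
              v * D.T (m + 1) * D.T m * D.T (m + 2) * D.T (m + 1) * D.Cc (m + 3) (k + 1) := by
            simp only [mul_assoc, ← c1.eq]
          simp only [mul_add, mul_one, mul_smul_comm, add_mul, smul_mul_assoc, smul_add,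
            smul_smul, ← mul_assoc]
          rw [f1, f2]
          module
        rw [e]
        refine ((hv.linked hm (by omega)).add (Linked.smul _ (linked_of_ends hm (by omega)
          ?_))).add (Linked.smul _ ?_)
        · cases k with
          | zero => rw [Cc_zero, mul_zero, defect, zero_mul, smul_zero, sub_zero]; exact Ends.zero _
          | succ k =>
          obtain ⟨t, ht⟩ := h.1 (by omega)
          rw [defect_mul_of_mul_T c1.symm.eq, defect_mul_of_mul_T (braid_shift (by omega)
            (by omega)), ht, mul_assoc t, ← mul_assoc (D.E _),
            D.E_succ_mul_T_mul_T (by omega) (by omega)]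
          exact Ends.mul_of_commute ⟨t * D.E (m + 2), (mul_assoc _ _ _).symm⟩
            (D.commute_E_of_commute_T (by omega) (by omega) c1.symm)
        · rcases Nat.lt_or_ge k 2 with hk2 | hk2
          · rw [Hh_one_eq_zero hk2, mul_zero]; exact Linked.zero m
          have d0 : Commute (D.T m) (D.Hh 1 (m + 3) k) :=
            commute_T_Hh hm (by omega) (by omega) (by omega) (by omega)
          have d1 : Commute (D.T (m + 1)) (D.Hh 1 (m + 3) k) :=
            commute_T_Hh (by omega) (by omega) (by omega) (by omega) (by omega)
          have c2 : D.T m * D.T (m + 2) = D.T (m + 2) * D.T m :=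
            (D.commute_T_T hm (by omega) (by omega) (by omega) (by omega)).eq
          have c3 : D.T m * D.T (m + 3) = D.T (m + 3) * D.T m :=
            (D.commute_T_T hm (by omega) (by omega) (by omega) (by omega)).eq
          have c4 : D.T (m + 1) * D.T (m + 3) = D.T (m + 3) * D.T (m + 1) :=
            (D.commute_T_T (by omega) (by omega) (by omega) (by omega) (by omega)).eq
          have s0 : D.T (m + 1) * D.T m * D.T (m + 2) * D.T (m + 1) * D.T (m + 3) *
              D.T (m + 2) * D.T m = D.T (m + 2) * (D.T (m + 1) * D.T m * D.T (m + 2) *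
              D.T (m + 1) * D.T (m + 3) * D.T (m + 2)) := by
            rw [mul_assoc _ (D.T (m + 2)), ← c2, ← mul_assoc, mul_assoc _ (D.T (m + 3)), ← c3,
              ← mul_assoc, T_mul_swap hm (by omega)]
            simp only [mul_assoc]
          have s1 : D.T (m + 1) * D.T m * D.T (m + 2) * D.T (m + 1) * D.T (m + 3) *
              D.T (m + 2) * D.T (m + 1) = D.T (m + 3) * (D.T (m + 1) * D.T m * D.T (m + 2) *
              D.T (m + 1) * D.T (m + 3) * D.T (m + 2)) := by
            have h4 := T_mul_swap (D := D) (i := m + 1) (by omega) (by omega)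
            simp only [add_assoc, Nat.reduceAdd] at h4
            calc _ = D.T (m + 1) * D.T m * (D.T (m + 2) * D.T (m + 1) * D.T (m + 3) *
                  D.T (m + 2) * D.T (m + 1)) := by simp only [mul_assoc]
              _ = D.T (m + 1) * (D.T m * D.T (m + 3)) * (D.T (m + 2) * D.T (m + 1) *
                  D.T (m + 3) * D.T (m + 2)) := by rw [h4]; simp only [mul_assoc]
              _ = (D.T (m + 1) * D.T (m + 3)) * D.T m * (D.T (m + 2) * D.T (m + 1) *
                  D.T (m + 3) * D.T (m + 2)) := by rw [c3]; simp only [mul_assoc]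
              _ = _ := by rw [c4]; simp only [mul_assoc]
          have s2 := congrArg (D.defect v (m + 2) * · * D.Hh 1 (m + 3) k)
            (D.mul_E_of_mul_T (by omega) (by omega) (by omega) (by omega) s1)
          rw [Linked, defect_mul_of_mul_T d1.symm.eq, defect_mul_of_mul_T d0.symm.eq,
            defect_mul_of_mul_T s1, defect_mul_of_mul_T s0, h.2 (m + 2) le_rfl (by omega),
            mul_assoc _ (D.Hh _ _ _) (D.E _), (D.commute_E_of_commute_T (by omega) (by omega)
              d1.symm).eq]
          simp only [mul_assoc] at s2 ⊢
          exact s2.symm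
      · have h1 := h.mul_Cc (by omega) (by omega)
        have h2 : D.Good (v * D.E (m + 1) * D.Hh 1 (m + 1) (k + 2)) (m + 1) (k + 2) :=
          ih (h.tail.mul_right (by omega) (by omega) fun j hj hj' => D.commute_E_T (by omega)
            (by omega) (by omega) (by omega) (by omega)) ⟨_, rfl⟩ (by omega) (by omega)
        rw [Hh_one_succ, mul_add, mul_smul_comm, ← mul_assoc, ← mul_assoc, hv.mul_T_mul_T hm (by omega)]
        exact (h1.2 i (by omega) (by omega)).add (Linked.smul _ (h2.2 i (by omega) (by omega)))

/-- The defect at the new arc of `v * D.Hh 1 m (k + 2)`. -/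
theorem Good.defect_mul_Hh_one {m k : ℕ} {v : A} (h : D.Good v (m + 2) k) (hv : D.Ends v m)
    (hm : 1 ≤ m) (hk : m + k + 1 ≤ n) :
    D.defect (v * D.Hh 1 m (k + 2)) m = (r⁻¹ - q ^ (2 * k + 1)) • v +
      q ^ 2 • (D.defect v (m + 2) * D.Hh 1 (m + 2) k) := by
  have e1 : D.defect v (m + 2) * (D.T (m + 1) * D.T m * D.T (m + 2) * D.T (m + 1)) *
      D.Hh 1 (m + 2) k = D.defect v (m + 2) * D.Hh 1 (m + 2) k := by
    rcases Nat.lt_or_ge k 2 with hk2 | hk2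
    · rw [Hh_one_eq_zero hk2, mul_zero, mul_zero]
    have h1 : D.Ends (D.defect v (m + 2)) m := by
      rw [defect_eq]
      refine hv.mul_of_commute (((D.commute_E_T hm (by omega) (by omega) (by omega)
        (by omega)).symm).sub_left ((Commute.one_left _).smul_left q))
    have := h1.mul_swap (h.1 hk2) hm (by omega)
    simp only [← mul_assoc, this]
  rw [hv.defect_mul_Hh_one hm hk, h.mul_Cc_eq (by omega) (by omega), e1]
  have h2 := mul_qnum D.hq k
  have h3 : q ^ (2 * k + 1) = q * (q * (q - q⁻¹) * qnum q k + 1) := by rw [h2]; ring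
  have := D.hq
  rw [h3]
  match_scalars <;> field_simp <;> ring

end BMWData

namespace BMWData

variable {F : Type*} [Field F] {A : Type*} [Ring A] [Algebra F A] {n : ℕ} {q r : F}
variable (D : BMWData F A n q r)

/-- The recursive form of the sum over the symmetric group on the points `m, …, m + k - 1`. -/
def Sh : ℕ → ℕ → A
  | _, 0 => 1
  | m, k + 1 => Sh (m + 1) k * D.Cc m (k + 1)

theorem Sh_zero (m : ℕ) : D.Sh m 0 = 1 := by rw [Sh]

theorem Sh_succ (m k : ℕ) : D.Sh m (k + 1) = D.Sh (m + 1) k * D.Cc m (k + 1) := by rw [Sh]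

theorem Ehat_succ (f : ℕ) : Ehat D.E (f + 1) = Ehat D.E f * D.E (2 * f + 1) := by
  simp [Ehat, List.range_succ]

variable {D}

theorem commute_Sh {x : A} {m k : ℕ} (h : ∀ j, m ≤ j → j + 1 < m + k → Commute x (D.T j)) :
    Commute x (D.Sh m k) := by
  induction k generalizing m with
  | zero => rw [Sh_zero]; exact Commute.one_right x
  | succ k ih =>
    rw [Sh_succ]
    exact (ih fun j hj hj' => h j (by omega) (by omega)).mul_right (commute_Cc h)

theorem commute_Ehat {x : A} {f : ℕ} (h : ∀ i < f, Commute x (D.E (2 * i + 1))) :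
    Commute x (Ehat D.E f) := by
  induction f with
  | zero => simp [Ehat]
  | succ f ih =>
    rw [Ehat_succ]
    exact (ih fun i hi => h i (by omega)).mul_right (h f (by omega))

theorem ends_Ehat {f : ℕ} (hf : 2 * f ≤ n) {i : ℕ} (hi : i < f) :
    D.Ends (Ehat D.E f) (2 * i + 1) := by
  induction f with
  | zero => omega
  | succ f ih =>
    rw [Ehat_succ]
    rcases Nat.lt_succ_iff_lt_or_eq.1 hi with hi | rfl
    · exact (ih (by omega) hi).mul_of_commute (D.commute_E_E (by omega) (by omega) (by omega)
        (by omega) (by omega))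
    · exact ⟨_, rfl⟩

theorem good_Sh (k : ℕ) {m : ℕ} (hm : 1 ≤ m) (hk : m + k ≤ n + 1) : D.Good (D.Sh m k) m k := by
  induction k generalizing m with
  | zero => exact ⟨fun h => by omega, fun i hi h => by omega⟩
  | succ k ih =>
    rw [Sh_succ]
    exact (ih (by omega) (by omega)).mul_Cc hm (by omega)

theorem T_sub_mul_Sh {m k : ℕ} (hm : 1 ≤ m) (hk : m + k + 1 ≤ n) :
    (D.T m - q • 1) * D.Sh m (k + 2) =
      -(q * (q - q⁻¹) * r⁻¹) • (D.E m * D.Sh (m + 2) k * D.Hh 1 m (k + 2)) := by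
  have c0 : Commute (D.T m) (D.Sh (m + 2) k) := commute_Sh fun j hj hj' =>
    D.commute_T_T hm (by omega) (by omega) (by omega) (by omega)
  have c1 := D.commute_E_of_commute_T hm (by omega) c0.symm
  have c2 : Commute (D.T m - q • 1) (D.Sh (m + 2) k) :=
    c0.sub_left ((Commute.one_left _).smul_left q)
  have c3 : Commute (D.T m - q • 1) (1 + q • D.T m) := by
    refine (Commute.one_right _).add_right (Commute.smul_right ?_ q)
    exact (Commute.refl _).sub_left ((Commute.one_left _).smul_left q)
  rw [Sh_succ, Sh_succ, mul_assoc, Cc_mul_Cc hm (by omega), ← mul_assoc, c2.eq, ← mul_assoc,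
    mul_assoc (D.Sh _ _), c3.eq, one_add_mul_sub hm (by omega), mul_smul_comm, smul_mul_assoc, c1.eq]

theorem T_sub_mul_left {f : ℕ} (hf : 2 * f + 2 ≤ n) :
    (D.T (2 * f + 1) - q • 1) * (Ehat D.E f * D.Sh (2 * f + 1) (n - 2 * f) * D.Hh f 1 n) =
      -(q * (q - q⁻¹) * r⁻¹ * qnum q (f + 1)) • (Ehat D.E (f + 1) *
        D.Sh (2 * (f + 1) + 1) (n - 2 * (f + 1)) * D.Hh (f + 1) 1 n) := by
  obtain ⟨l, hl⟩ : ∃ l, n = 2 * f + l + 2 := ⟨n - 2 * f - 2, by omega⟩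
  have c1 : Commute (D.T (2 * f + 1) - q • 1) (Ehat D.E f) := by
    refine (commute_Ehat fun i hi => ?_).sub_left ((Commute.one_left _).smul_left q)
    exact (D.commute_E_T (by omega) (by omega) (by omega) (by omega) (by omega)).symm
  have c2 : Commute (Ehat D.E (f + 1)) (D.Sh (2 * f + 3) l) := commute_Sh fun j hj hj' =>
    (commute_Ehat fun i hi => (D.commute_E_T (by omega) (by omega) (by omega) (by omega)
      (by omega)).symm).symm
  have hK := mul_Hh_one_mul_Hh (D := D) f l 1 (Ehat D.E (f + 1)) le_rfl (by omega)
    fun i hi => by rw [add_comm 1]; exact ends_Ehat (by omega) (by omega)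
  rw [← hl, add_comm 1] at hK
  have e1 : n - 2 * f = l + 2 := by omega
  have e2 : n - 2 * (f + 1) = l := by omega
  have e3 : 2 * (f + 1) + 1 = 2 * f + 3 := by omega
  rw [e1, e2, e3, ← mul_assoc, ← mul_assoc, c1.eq, mul_assoc (Ehat D.E f),
    T_sub_mul_Sh (by omega) (by omega), mul_smul_comm, ← mul_assoc, ← mul_assoc, ← Ehat_succ,
    c2.eq, smul_mul_assoc, mul_assoc (D.Sh _ _), mul_assoc (D.Sh _ _), hK, mul_smul_comm,
    smul_smul, mul_assoc (D.Sh _ _), neg_mul]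

variable (D) in
/-- A sequence of elements with successively more arcs at the bottom, each being determined by
the first defect of the previous one. -/
structure Tower (u : ℕ → A) : Prop where
  good : ∀ f, 2 * f ≤ n → D.Good (u f) (2 * f + 1) (n - 2 * f)
  ends : ∀ f, 2 * f ≤ n → ∀ i < f, D.Ends (u f) (2 * i + 1)
  defect_eq : ∀ f, 2 * f + 2 ≤ n → D.defect (u f) (2 * f + 1) =
    -(q * (q - q⁻¹) * r⁻¹ * qnum q (f + 1)) • u (f + 1)

variable (D) in
/-- The products of `u (h + g)` with `g` one-arc sums. -/
def tow (u : ℕ → A) : ℕ → ℕ → A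
  | h, 0 => u h
  | h, g + 1 => tow u (h + 1) g * D.Hh 1 (2 * h + 1) (n - 2 * h)

theorem tow_zero (u : ℕ → A) (h : ℕ) : D.tow u h 0 = u h := by rw [tow]

theorem tow_succ (u : ℕ → A) (h g : ℕ) :
    D.tow u h (g + 1) = D.tow u (h + 1) g * D.Hh 1 (2 * h + 1) (n - 2 * h) := by rw [tow]

theorem tow_eq_zero (u : ℕ → A) (h g : ℕ) (hn : n < 2 * (h + g + 1)) :
    D.tow u h (g + 1) = 0 := by
  induction g generalizing h with
  | zero => rw [tow_succ, Hh_one_eq_zero (by omega), mul_zero]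
  | succ g ih => rw [tow_succ, ih _ (by omega), zero_mul]

namespace Tower

variable {u : ℕ → A}

theorem ends_tow (hu : D.Tower u) {h g i : ℕ} (hn : 2 * (h + g) ≤ n) (hi : i < h) :
    D.Ends (D.tow u h g) (2 * i + 1) := by
  induction g generalizing h with
  | zero => rw [tow_zero]; exact hu.ends h (by omega) i hi
  | succ g ih =>
    rw [tow_succ]
    refine (ih (by omega) (by omega)).mul_of_commute (D.commute_E_of_commute_T (by omega)
      (by omega) (commute_T_Hh (by omega) (by omega) (by omega) (by omega) (by omega)).symm)

theorem good_tow (hu : D.Tower u) {h g : ℕ} (hn : 2 * (h + g) ≤ n) :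
    D.Good (D.tow u h g) (2 * h + 1) (n - 2 * h) := by
  induction g generalizing h with
  | zero => rw [tow_zero]; exact hu.good h (by omega)
  | succ g ih =>
    have := ih (h := h + 1) (by omega)
    obtain ⟨k, hk⟩ : ∃ k, n - 2 * h = k + 2 := ⟨n - 2 * h - 2, by omega⟩
    rw [show n - 2 * (h + 1) = k by omega] at this
    rw [tow_succ, hk]
    exact Good.mul_Hh_one (m := 2 * h + 1) this (hu.ends_tow (by omega) (by omega)) (by omega) (by omega)

theorem tow_eq (hu : D.Tower u) {h g : ℕ} (hn : 2 * (h + g) ≤ n) :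
    D.tow u h g = (∏ i ∈ range g, qnum q (i + 1)) • (u (h + g) *
      D.Hh g (2 * h + 1) (n - 2 * h)) := by
  induction g generalizing h with
  | zero => simp [tow_zero, Hh_zero]
  | succ g ih =>
    obtain ⟨l, hl⟩ : ∃ l, n = 2 * h + 2 * g + l + 2 := ⟨n - 2 * h - 2 * g - 2, by omega⟩
    have hK := mul_Hh_mul_Hh_one (D := D) (f := g) (l := l) (m := 2 * h + 1) (x := u (h + (g + 1)))
      (by omega) (by omega) fun i hi => by
        rw [show 2 * h + 1 + 2 * i = 2 * (h + i) + 1 by omega]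
        exact hu.ends _ (by omega) _ (by omega)
    rw [tow_succ, ih (by omega), show n - 2 * h = 2 * g + l + 2 by omega,
      show n - 2 * (h + 1) = 2 * g + l by omega, show h + 1 + g = h + (g + 1) by omega,
      show 2 * (h + 1) + 1 = 2 * h + 1 + 2 by omega, smul_mul_assoc, hK, smul_smul,
      prod_range_succ]

theorem defect_tow_succ_of (hu : D.Tower u) {h g p : ℕ} (hn : n = 2 * (h + (g + 1)) + p) {b : F}
    (H : D.defect (D.tow u (h + 1) g) (2 * (h + 1) + 1) *
      D.Hh 1 (2 * (h + 1) + 1) (n - 2 * (h + 1)) =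
      (qnum q g * (r⁻¹ - q ^ (2 * p + 2 * g) * q⁻¹)) • D.tow u (h + 1) g +
      (q ^ (2 * g) * b) • D.tow u (h + 1) (g + 1)) :
    D.defect (D.tow u h (g + 1)) (2 * h + 1) =
      (qnum q (g + 1) * (r⁻¹ - q ^ (2 * p + 2 * (g + 1)) * q⁻¹)) • D.tow u (h + 1) g +
      (q ^ (2 * (g + 1)) * b) • D.tow u (h + 1) (g + 1) := by
  have hg := hu.good_tow (h := h + 1) (g := g) (by omega)
  have hk : n - 2 * (h + 1) = 2 * g + p := by omega
  rw [hk] at hg H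
  have e : qnum q (g + 1) * (r⁻¹ - q ^ (2 * p + 2 * (g + 1)) * q⁻¹) =
      r⁻¹ - q ^ (2 * (2 * g + p) + 1) +
        q ^ 2 * (qnum q g * (r⁻¹ - q ^ (2 * p + 2 * g) * q⁻¹)) := by
    have h1 := qnum_succ' q g
    have h2 := qnum_succ q g
    have := D.hq
    have e1 : q ^ (2 * (2 * g + p) + 1) = q ^ (2 * p + 2 * (g + 1)) * q⁻¹ * q ^ (2 * g) := by
      field_simp; ring
    rw [e1]
    linear_combination r⁻¹ * h1 - q ^ (2 * p + 2 * (g + 1)) * q⁻¹ * h2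
  rw [tow_succ u h, show n - 2 * h = 2 * g + p + 2 by omega, Good.defect_mul_Hh_one (m := 2 * h + 1)
    hg (hu.ends_tow (by omega) (by omega)) (by omega) (by omega)]
  have H' : D.defect (D.tow u (h + 1) g) (2 * h + 1 + 2) * D.Hh 1 (2 * h + 1 + 2) (2 * g + p) =
    (qnum q g * (r⁻¹ - q ^ (2 * p + 2 * g) * q⁻¹)) • D.tow u (h + 1) g +
      (q ^ (2 * g) * b) • D.tow u (h + 1) (g + 1) := H
  rw [H', e]
  module

theorem defect_tow_mul_Hh_one (hu : D.Tower u) {h g p : ℕ} (hn : n = 2 * (h + g) + p) :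
    D.defect (D.tow u h g) (2 * h + 1) * D.Hh 1 (2 * h + 1) (n - 2 * h) =
      (qnum q g * (r⁻¹ - q ^ (2 * p + 2 * g) * q⁻¹)) • D.tow u h g +
      (q ^ (2 * g) * -(q * (q - q⁻¹) * r⁻¹ * qnum q (h + g + 1))) • D.tow u h (g + 1) := by
  induction g generalizing h with
  | zero =>
    rcases Nat.lt_or_ge p 2 with hp | hp
    · rw [Hh_one_eq_zero (by omega), mul_zero, qnum_zero, zero_mul, zero_smul,
        tow_eq_zero u h 0 (by omega), smul_zero, add_zero]
    · rw [tow_succ, tow_zero, tow_zero, hu.defect_eq h (by omega), qnum_zero, zero_mul, zero_smul,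
        smul_mul_assoc]
      simp
  | succ g ih =>
    rw [hu.defect_tow_succ_of hn (ih (h := h + 1) (by omega)), add_mul, smul_mul_assoc,
      smul_mul_assoc, ← tow_succ, ← tow_succ, show h + 1 + g + 1 = h + (g + 1) + 1 by omega]

theorem defect_sum (hu : D.Tower u) {c : ℕ → F} (hn : 2 ≤ n)
    (hc : ∀ g p, n = 2 * (g + 1) + p → c (g + 1) * (1 - r * q ^ (2 * p + 2 * g) * q) =
      c g * q ^ (2 * g) * (q ^ 2 - 1)) {M : ℕ} (hM : 2 * M ≤ n) :
    D.defect (∑ f ∈ range (M + 1), c f • D.tow u 0 f) 1 =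
      (c M * (q ^ (2 * M) * -(q * (q - q⁻¹) * r⁻¹ * qnum q (M + 1)))) • D.tow u 1 M := by
  induction M with
  | zero =>
    rw [zero_add, range_one, sum_singleton, tow_zero, tow_zero, defect_smul,
      hu.defect_eq 0 (by omega), smul_smul]
    simp
  | succ g ih =>
    obtain ⟨p, hp⟩ : ∃ p, n = 2 * (g + 1) + p := ⟨n - 2 * (g + 1), by omega⟩
    have h1 := hu.defect_tow_succ_of (h := 0) (by omega)
      (hu.defect_tow_mul_Hh_one (h := 0 + 1) (g := g) (p := p) (by omega))
    simp only [mul_zero, zero_add] at h1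
    rw [sum_range_succ, defect_add, defect_smul, ih (by omega), h1, add_comm 1 g, smul_add,
      smul_smul, smul_smul, ← add_assoc, ← add_smul]
    have h2 := hc g p hp
    have := D.hq
    have := D.hr
    have h3 : c g * (q ^ (2 * g) * -(q * (q - q⁻¹) * r⁻¹ * qnum q (g + 1))) +
        c (g + 1) * (qnum q (g + 1) * (r⁻¹ - q ^ (2 * p + 2 * (g + 1)) * q⁻¹)) = 0 := by
      have e1 : q * (q - q⁻¹) = q ^ 2 - 1 := by field_simp
      have e2 : r⁻¹ - q ^ (2 * p + 2 * (g + 1)) * q⁻¹ =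
          r⁻¹ * (1 - r * q ^ (2 * p + 2 * g) * q) := by
        field_simp; ring
      rw [e1, e2]
      linear_combination r⁻¹ * qnum q (g + 1) * h2
    rw [h3, zero_smul, zero_add]

theorem sum_mul_T (hu : D.Tower u) {c : ℕ → F}
    (hc : ∀ g p, n = 2 * (g + 1) + p → c (g + 1) * (1 - r * q ^ (2 * p + 2 * g) * q) =
      c g * q ^ (2 * g) * (q ^ 2 - 1)) {i : ℕ} (hi : 1 ≤ i) (hin : i < n) :
    (∑ f ∈ range (n / 2 + 1), c f • D.tow u 0 f) * D.T i =
      q • ∑ f ∈ range (n / 2 + 1), c f • D.tow u 0 f := by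
  have hg : D.Good (∑ f ∈ range (n / 2 + 1), c f • D.tow u 0 f) 1 n := by
    refine Good.sum fun f hf => Good.smul _ ?_
    have := mem_range.1 hf
    simpa using hu.good_tow (h := 0) (g := f) (by omega)
  have h0 := hu.defect_sum (by omega) hc (M := n / 2) (by omega)
  obtain ⟨g, hM⟩ : ∃ g, n / 2 = g + 1 := ⟨n / 2 - 1, by omega⟩
  rw [hM, tow_eq_zero u 1 g (by omega), smul_zero, ← hM] at h0
  have key : D.defect (∑ f ∈ range (n / 2 + 1), c f • D.tow u 0 f) i = 0 := by
    induction i with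
    | zero => omega
    | succ i ih =>
      rcases Nat.eq_zero_or_pos i with rfl | hi'
      · exact h0
      · rw [hg.2 i hi' (by omega), ih hi' (by omega), zero_mul]
  exact sub_eq_zero.1 key

end Tower

end BMWData

section Perm

variable {n : ℕ}

/-- A permutation of `Fin n`, extended to a function on the natural numbers. -/
def ev (w : Equiv.Perm (Fin n)) (x : ℕ) : ℕ := if h : x < n then (w ⟨x, h⟩ : ℕ) else x

theorem ev_coe (w : Equiv.Perm (Fin n)) (a : Fin n) : ev w a = w a := by simp [ev]

theorem ev_of_le (w : Equiv.Perm (Fin n)) {x : ℕ} (h : n ≤ x) : ev w x = x := by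
  simp [ev, Nat.not_lt.2 h]

theorem ev_lt (w : Equiv.Perm (Fin n)) {x : ℕ} (h : x < n) : ev w x < n := by
  simp [ev, h]

theorem ev_one (x : ℕ) : ev (1 : Equiv.Perm (Fin n)) x = x := by
  by_cases h : x < n <;> simp [ev, h]

theorem ev_mul (u v : Equiv.Perm (Fin n)) (x : ℕ) : ev (u * v) x = ev u (ev v x) := by
  by_cases h : x < n <;> simp [ev, h]

theorem ev_inv_ev (w : Equiv.Perm (Fin n)) (x : ℕ) : ev w⁻¹ (ev w x) = x := by
  rw [← ev_mul, inv_mul_cancel, ev_one]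

theorem ev_ev_inv (w : Equiv.Perm (Fin n)) (x : ℕ) : ev w (ev w⁻¹ x) = x := by
  rw [← ev_mul, mul_inv_cancel, ev_one]

theorem ev_injective (w : Equiv.Perm (Fin n)) : Function.Injective (ev w) :=
  Function.LeftInverse.injective (ev_inv_ev w)

theorem perm_ext {u v : Equiv.Perm (Fin n)} (h : ∀ x, ev u x = ev v x) : u = v := by
  ext a
  rw [← ev_coe, ← ev_coe, h]

theorem ev_sGen {i : ℕ} (hi : i + 1 < n) (x : ℕ) :
    ev (sGen n (i + 1)) x = if x = i then i + 1 else if x = i + 1 then i else x := by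
  have h : 1 ≤ i + 1 ∧ i + 1 < n := ⟨by omega, hi⟩
  by_cases hx : x < n
  · simp only [ev, hx, sGen, h, dif_pos, Nat.add_sub_cancel]
    simp only [and_self, dite_true, Equiv.swap_apply_def, Fin.ext_iff]
    split_ifs <;> simp
  · rw [ev_of_le _ (by omega), if_neg (by omega), if_neg (by omega)]

theorem len_one : len (1 : Equiv.Perm (Fin n)) = 0 := by
  rw [len, card_eq_zero, filter_eq_empty_iff]
  exact fun p _ h => lt_asymm h.1 h.2

theorem len_inv (w : Equiv.Perm (Fin n)) : len w⁻¹ = len w := by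
  refine card_nbij' (fun p => (w⁻¹ p.2, w⁻¹ p.1)) (fun p => (w p.2, w p.1)) ?_ ?_ ?_ ?_ <;>
  simp +contextual [Set.MapsTo, Set.LeftInvOn]

theorem len_mul_sGen {w : Equiv.Perm (Fin n)} {i : ℕ} (hi : i + 1 < n)
    (h : ev w i < ev w (i + 1)) : len (w * sGen n (i + 1)) = len w + 1 := by
  have hw : w ⟨i, by omega⟩ < w ⟨i + 1, hi⟩ := by
    simpa [ev, hi, show i < n by omega] using h
  have hs : sGen n (i + 1) = Equiv.swap ⟨i, by omega⟩ ⟨i + 1, hi⟩ := by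
    simp [sGen, hi]
  set a : Fin n := ⟨i, by omega⟩ with ha
  set b : Fin n := ⟨i + 1, hi⟩ with hb
  have hab : a < b := by simp [ha, hb]
  have key : ∀ x y : Fin n, (x < y ∧ w (Equiv.swap a b y) < w (Equiv.swap a b x)) ↔
      ((x = a ∧ y = b) ∨ (Equiv.swap a b x < Equiv.swap a b y ∧
        w (Equiv.swap a b y) < w (Equiv.swap a b x))) := by
    intro x y
    have h1 : ∀ z : Fin n, z ≠ a → z ≠ b → (z < a ↔ z < b) ∧ (a < z ↔ b < z) := by
      intro z hz hz'
      simp only [ha, hb, Fin.ext_iff, Fin.lt_def, ne_eq] at *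
      omega
    rcases eq_or_ne x a with rfl | hxa
    · rcases eq_or_ne y b with rfl | hyb
      · simp [hab, hw]
      · rcases eq_or_ne y a with rfl | hya
        · simp [hab.ne]
        · rw [Equiv.swap_apply_left, Equiv.swap_apply_of_ne_of_ne hya hyb, (h1 y hya hyb).2]
          simp [hyb]
    · rcases eq_or_ne x b with rfl | hxb
      · rcases eq_or_ne y a with rfl | hya
        · simp [hab, hw.le, hxa]
        · rcases eq_or_ne y b with rfl | hyb
          · simp [hab.ne']
          · rw [Equiv.swap_apply_right, Equiv.swap_apply_of_ne_of_ne hya hyb, (h1 y hya hyb).2]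
            simp [hxa]
      · rw [Equiv.swap_apply_of_ne_of_ne hxa hxb]
        rcases eq_or_ne y a with rfl | hya
        · rw [Equiv.swap_apply_left, (h1 x hxa hxb).1]; simp [hxa]
        · rcases eq_or_ne y b with rfl | hyb
          · rw [Equiv.swap_apply_right, (h1 x hxa hxb).1]; simp [hxa]
          · rw [Equiv.swap_apply_of_ne_of_ne hya hyb]; simp [hxa]
  have hI : univ.filter (fun p : Fin n × Fin n => p.1 < p.2 ∧
      (w * sGen n (i + 1)) p.2 < (w * sGen n (i + 1)) p.1) =
      insert (a, b) ((univ.filter (fun p : Fin n × Fin n => p.1 < p.2 ∧ w p.2 < w p.1)).map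
        ((Equiv.swap a b).prodCongr (Equiv.swap a b)).toEmbedding) := by
    ext ⟨x, y⟩
    rw [mem_insert, mem_map_equiv]
    simp only [mem_filter, mem_univ, true_and, hs, Equiv.Perm.mul_apply, Prod.mk.injEq,
      Equiv.prodCongr_symm, Equiv.symm_swap, Equiv.prodCongr_apply, Prod.map_apply]
    exact key x y
  rw [len, hI, card_insert_of_notMem, card_map, len]
  rw [mem_map_equiv]
  simp [hab.le]

/-- `w` fixes the first `t` points. -/
def Fixes (t : ℕ) (w : Equiv.Perm (Fin n)) : Prop := ∀ x < t, ev w x = x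

theorem Fixes.inv {t : ℕ} {w : Equiv.Perm (Fin n)} (h : Fixes t w) : Fixes t w⁻¹ := fun x hx => by
  conv_lhs => rw [← h x hx, ev_inv_ev]

theorem Fixes.le {t : ℕ} {w : Equiv.Perm (Fin n)} (h : Fixes t w) {x : ℕ} (hx : t ≤ x) :
    t ≤ ev w x := by
  by_contra! hx'
  have := h.inv _ hx'
  rw [ev_inv_ev] at this
  omega

theorem mem_fixSet {t : ℕ} {w : Equiv.Perm (Fin n)} : w ∈ fixSet n t ↔ Fixes t w := by
  simp only [fixSet, mem_filter, mem_univ, true_and, Fixes]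
  refine ⟨fun h x hx => ?_, fun h a ha => Fin.ext ?_⟩
  · by_cases hn : x < n
    · simp [ev, hn, h ⟨x, hn⟩ hx]
    · exact ev_of_le _ (by omega)
  · rw [← ev_coe, h _ ha]

/-- The cycle `s_{t+1} s_{t+2} ⋯ s_{t+j}`. -/
def asc (n t : ℕ) : ℕ → Equiv.Perm (Fin n)
  | 0 => 1
  | j + 1 => asc n t j * sGen n (t + j + 1)

theorem ev_asc {t j : ℕ} (h : j = 0 ∨ t + j < n) (x : ℕ) :
    ev (asc n t j) x = if x = t + j then t else if t ≤ x ∧ x < t + j then x + 1 else x := by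
  induction j generalizing x with
  | zero => rw [asc, ev_one]; split_ifs <;> omega
  | succ j ih =>
    rw [asc, ev_mul, ev_sGen (by omega), ih (by omega)]
    split_ifs <;> omega

theorem len_mul_asc {w : Equiv.Perm (Fin n)} {t j : ℕ} (hw : Fixes (t + 1) w)
    (h : j = 0 ∨ t + j < n) : len (w * asc n t j) = len w + j := by
  induction j with
  | zero => rw [asc, mul_one, add_zero]
  | succ j ih =>
    rw [asc, ← mul_assoc, len_mul_sGen (by omega), ih (by omega), add_assoc]
    rw [ev_mul, ev_mul, ev_asc (by omega), ev_asc (by omega), if_pos rfl, if_neg (by omega),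
      if_neg (by omega), hw t (by omega)]
    exact hw.le (by omega)

theorem len_asc {t j : ℕ} (h : j = 0 ∨ t + j < n) : len (asc n t j) = j := by
  have := len_mul_asc (n := n) (w := 1) (t := t) (fun x _ => ev_one x) h
  rwa [one_mul, len_one, zero_add] at this

end Perm

namespace BMWData

variable {F : Type*} [Field F] {A : Type*} [Ring A] [Algebra F A] {n : ℕ} {q r : F}
variable (D : BMWData F A n q r)

/-- The ascending product `T_m T_{m+1} ⋯ T_{m+j-1}`. -/
def Up (m : ℕ) : ℕ → A
  | 0 => 1
  | j + 1 => Up m j * D.T (m + j)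

theorem Up_succ' (m j : ℕ) : D.Up m (j + 1) = D.T m * D.Up (m + 1) j := by
  induction j with
  | zero => simp [Up]
  | succ j ih => rw [Up, ih, Up, mul_assoc, ← add_assoc, add_right_comm]

theorem Cc_eq_sum (m k : ℕ) : D.Cc m k = ∑ j ∈ range k, q ^ j • D.Up m j := by
  induction k generalizing m with
  | zero => simp [Cc_zero]
  | succ k ih =>
    rw [Cc_succ, ih, sum_range_succ', mul_sum, smul_sum, add_comm]
    congr 1
    · refine sum_congr rfl fun j _ => ?_
      rw [Up_succ', mul_smul_comm, smul_smul, pow_succ']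
    · simp [Up]

theorem Tw_mul_asc {w : Equiv.Perm (Fin n)} {t j : ℕ} (hw : Fixes (t + 1) w)
    (h : j = 0 ∨ t + j < n) : D.Tw (w * asc n t j) = D.Tw w * D.Up (t + 1) j := by
  induction j with
  | zero => rw [asc, mul_one, Up, mul_one]
  | succ j ih =>
    have h1 := len_mul_asc hw h
    have h2 := len_mul_asc (j := j) hw (by omega)
    have h3 := len_mul_sGen (n := n) (w := 1) (i := t + j) (by omega)
      (by rw [ev_one, ev_one]; omega)
    rw [one_mul, len_one] at h3
    rw [asc, ← mul_assoc] at h1 ⊢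
    rw [D.Tw_mul _ _ (by omega), ih (by omega), D.Tw_s _ (by omega) (by omega), Up, mul_assoc,
      show t + 1 + j = t + j + 1 by omega]

theorem Tw_asc_inv {t j : ℕ} (h : j = 0 ∨ t + j < n) :
    D.Tw (asc n t j)⁻¹ = D.Dn (t + 1) j := by
  induction j with
  | zero => rw [asc, inv_one, D.Tw_one, Dn_zero]
  | succ j ih =>
    have h1 := len_asc h
    have h2 := len_asc (n := n) (t := t) (j := j) (by omega)
    have h3 := len_mul_sGen (n := n) (w := 1) (i := t + j) (by omega)
      (by rw [ev_one, ev_one]; omega)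
    have h4 : (sGen n (t + j + 1))⁻¹ = sGen n (t + j + 1) := by
      rw [sGen, dif_pos (by omega), Equiv.swap_inv]
    rw [one_mul, len_one] at h3
    rw [← len_inv, asc, mul_inv_rev, h4] at h1
    rw [asc, mul_inv_rev, h4, D.Tw_mul _ _ (by rw [len_inv]; omega), ih (by omega),
      D.Tw_s _ (by omega) (by omega), Dn_succ, show t + 1 + j = t + j + 1 by omega]

variable {D}

theorem hat_mul_Cc {X Y : Finset (Equiv.Perm (Fin n))} {t k : ℕ} (hk : k = 0 ∨ t + k ≤ n)
    (hX : ∀ d ∈ X, Fixes (t + 1) d)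
    (hY : ∀ w, w ∈ Y ↔ ∃ d ∈ X, ∃ j < k, w = d * asc n t j) :
    hat q D.Tw Y = hat q D.Tw X * D.Cc (t + 1) k := by
  have hY' : Y = (X ×ˢ range k).image fun p => p.1 * asc n t p.2 := by
    ext w
    simp only [hY, mem_image, mem_product, mem_range, Prod.exists]
    exact ⟨fun ⟨d, hd, j, hj, h⟩ => ⟨d, j, ⟨hd, hj⟩, h.symm⟩,
      fun ⟨d, j, ⟨hd, hj⟩, h⟩ => ⟨d, hd, j, hj, h.symm⟩⟩
  rw [hat, hY', sum_image, sum_product, hat, Cc_eq_sum, sum_mul_sum]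
  · refine sum_congr rfl fun d hd => sum_congr rfl fun j hj => ?_
    have := mem_range.1 hj
    rw [len_mul_asc (hX d hd) (by omega), D.Tw_mul_asc (hX d hd) (by omega), pow_add,
      smul_mul_smul_comm]
  · rintro ⟨d, j⟩ hp ⟨d', j'⟩ hp' h
    simp only [coe_product, Set.mem_prod, mem_coe, mem_range] at hp hp'
    have key : ∀ (d : Equiv.Perm (Fin n)) (j : ℕ), d ∈ X → j < k →
        ev (d * asc n t j) (t + j) = t := fun d j hd hj => by
      rw [ev_mul, ev_asc (by omega), if_pos rfl, hX d hd t (by omega)]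
    have hj : t + j = t + j' := by
      apply ev_injective (d * asc n t j)
      rw [key d j hp.1 hp.2]
      simp only at h
      rw [h, key d' j' hp'.1 hp'.2]
    obtain rfl : j = j' := by omega
    simpa using h

theorem hat_fixSet {k t : ℕ} (h : t + k = n) :
    hat q D.Tw (fixSet n t) = D.Sh (t + 1) k := by
  induction k generalizing t with
  | zero =>
    have : fixSet n t = {1} := by
      ext w
      rw [mem_fixSet, mem_singleton]
      refine ⟨fun hw => perm_ext fun x => ?_, ?_⟩
      · rw [ev_one]
        rcases Nat.lt_or_ge x t with hx | hx
        · exact hw x hx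
        · exact ev_of_le _ (by omega)
      · rintro rfl x _
        exact ev_one x
    rw [this, hat, sum_singleton, len_one, D.Tw_one, pow_zero, one_smul, Sh_zero]
  | succ k ih =>
    rw [Sh_succ, ← ih (by omega)]
    refine hat_mul_Cc (by omega) (fun d hd => mem_fixSet.1 hd) fun w => ?_
    rw [mem_fixSet]
    constructor
    · intro hw
      have h1 := hw.inv.le (le_refl t)
      have h2 := ev_lt w⁻¹ (x := t) (by omega)
      obtain ⟨j, hj⟩ : ∃ j, ev w⁻¹ t = t + j := ⟨ev w⁻¹ t - t, by omega⟩
      refine ⟨w * (asc n t j)⁻¹, mem_fixSet.2 fun x hx => ?_, j, by omega, by simp⟩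
      have h3 := ev_ev_inv (asc n t j) x
      rw [ev_asc (by omega)] at h3
      rw [ev_mul]
      rcases Nat.lt_or_ge x t with hx | hx
      · rw [show ev (asc n t j)⁻¹ x = x by split_ifs at h3 <;> omega, hw x hx]
      · rw [show ev (asc n t j)⁻¹ x = t + j by split_ifs at h3 <;> omega, ← hj, ev_ev_inv]
        omega
    · rintro ⟨d, hd, j, hj, rfl⟩ x hx
      rw [ev_mul, ev_asc (by omega), if_neg (by omega), if_neg (by omega),
        mem_fixSet.1 hd x (by omega)]

end BMWData

section Perm

variable {n : ℕ}

/-- The order conditions on the inverses of the permutations in `H_f`, for arcs on the points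
from `s` on. -/
structure ArcOrder (s f : ℕ) (e : Equiv.Perm (Fin n)) : Prop where
  fixes : Fixes s e
  left_lt : ∀ i, i + 1 < f → ev e (s + 2 * i) < ev e (s + 2 * i + 2)
  left_lt_right : ∀ i < f, ev e (s + 2 * i) < ev e (s + 2 * i + 1)
  free_lt : ∀ x, s + 2 * f ≤ x → x + 1 < n → ev e x < ev e (x + 1)

open scoped Classical in
/-- The permutations whose inverses have `f` arcs on the points from `s` on. -/
noncomputable def arcSet (n s f : ℕ) : Finset (Equiv.Perm (Fin n)) :=
  univ.filter fun d => ArcOrder s f d⁻¹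

theorem mem_arcSet {s f : ℕ} {d : Equiv.Perm (Fin n)} : d ∈ arcSet n s f ↔ ArcOrder s f d⁻¹ := by
  simp [arcSet]

theorem Fixes.lt {t : ℕ} {w : Equiv.Perm (Fin n)} (h : Fixes t w) {x : ℕ} (hx : t ≤ x)
    (h0 : ev w t = t) (hxt : x ≠ t) : t < ev w x := by
  have := h.le hx
  have := (ev_injective w).ne hxt
  omega

theorem ArcOrder.eq_one {s : ℕ} {e : Equiv.Perm (Fin n)} (h : ArcOrder s 0 e) : e = 1 := by
  have hm : StrictMono fun a : Fin n => e a := by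
    cases n with
    | zero => exact Subsingleton.strictMono _
    | succ n =>
      refine Fin.strictMono_iff_lt_succ.2 fun i => ?_
      have : ev e i < ev e (i + 1) := by
        rcases Nat.lt_or_ge i s with hi | hi
        · rw [h.fixes i hi]
          rcases Nat.lt_or_ge (i + 1) s with hi' | hi'
          · rw [h.fixes _ hi']; omega
          · have := h.fixes.le hi'; omega
        · exact h.free_lt _ (by omega) (by omega)
      rw [Fin.lt_def, ← ev_coe, ← ev_coe]
      simpa using this
  have := hm.range_inj strictMono_id |>.1
    (by rw [Set.range_id, Set.range_eq_univ]; exact e.surjective)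
  exact Equiv.ext fun a => congrFun this a

theorem arcOrder_one (s : ℕ) : ArcOrder s 0 (1 : Equiv.Perm (Fin n)) :=
  ⟨fun x _ => ev_one x, fun i hi => by omega, fun i hi => by omega,
    fun x _ _ => by rw [ev_one, ev_one]; omega⟩

theorem arcOrder_asc_mul {s f j : ℕ} {e : Equiv.Perm (Fin n)} (hj : j = 0 ∨ s + 1 + j < n) :
    ArcOrder (s + 2) f (asc n (s + 1) j * e) ↔
      ArcOrder s (f + 1) e ∧ ev e s = s ∧ ev e (s + 1) = s + 1 + j := by
  have rel : ∀ x, ev (asc n (s + 1) j * e) x = _ := fun x => by rw [ev_mul, ev_asc hj]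
  have mono : ∀ x y, ev e x ≠ s + 1 + j → ev e y ≠ s + 1 + j →
      (ev (asc n (s + 1) j * e) x < ev (asc n (s + 1) j * e) y ↔ ev e x < ev e y) := by
    intro x y hx hy
    rw [rel, rel, if_neg hx, if_neg hy]
    split_ifs <;> omega
  constructor
  · intro h
    have h0 : ∀ x ≤ s, ev e x = x := fun x hx => by
      have h1 := h.fixes x (by omega)
      rw [rel] at h1
      split_ifs at h1 <;> omega
    have h1 : ev e (s + 1) = s + 1 + j := by
      have h1 := h.fixes (s + 1) (by omega)
      rw [rel] at h1
      split_ifs at h1 <;> omega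
    have hs : Fixes s e := fun x hx => h0 x hx.le
    have ne : ∀ x, s + 2 ≤ x → ev e x ≠ s + 1 + j := fun x hx => by
      rw [← h1]; exact (ev_injective e).ne (by omega)
    have lt : ∀ x, s < x → ev e s < ev e x := fun x hx => by
      rw [h0 s le_rfl]; exact hs.lt hx.le (h0 s le_rfl) (by omega)
    refine ⟨⟨hs, fun i hi => ?_, fun i hi => ?_, fun x hx hxn => ?_⟩, h0 s le_rfl, h1⟩
    · cases i with
      | zero => exact lt _ (by omega)
      | succ i =>
        have := h.left_lt i (by omega)
        rw [mono _ _ (ne _ (by omega)) (ne _ (by omega))] at this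
        convert this using 2 <;> omega
    · cases i with
      | zero => exact lt _ (by omega)
      | succ i =>
        have := h.left_lt_right i (by omega)
        rw [mono _ _ (ne _ (by omega)) (ne _ (by omega))] at this
        convert this using 2 <;> omega
    · exact (mono _ _ (ne _ (by omega)) (ne _ (by omega))).1 (h.free_lt x (by omega) hxn)
  · rintro ⟨h, h0, h1⟩
    have ne : ∀ x, s + 2 ≤ x → ev e x ≠ s + 1 + j := fun x hx => by
      rw [← h1]; exact (ev_injective e).ne (by omega)
    refine ⟨fun x hx => ?_, fun i hi => ?_, fun i hi => ?_, fun x hx hxn => ?_⟩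
    · rw [rel]
      rcases Nat.lt_trichotomy x s with hx | rfl | hx
      · rw [h.fixes x hx, if_neg (by omega), if_neg (by omega)]
      · rw [h0, if_neg (by omega), if_neg (by omega)]
      · rw [show x = s + 1 by omega, h1, if_pos rfl]
    · rw [mono _ _ (ne _ (by omega)) (ne _ (by omega))]
      convert h.left_lt (i + 1) (by omega) using 2 <;> omega
    · rw [mono _ _ (ne _ (by omega)) (ne _ (by omega))]
      convert h.left_lt_right (i + 1) (by omega) using 2 <;> omega
    · rw [mono _ _ (ne _ (by omega)) (ne _ (by omega))]
      exact h.free_lt x (by omega) hxn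

theorem ArcOrder.ev_eq {s f : ℕ} {e : Equiv.Perm (Fin n)} (h : ArcOrder s f e)
    (h0 : ev e s ≠ s) : s + 2 * f < n ∧ ev e (s + 2 * f) = s := by
  obtain ⟨x, hx⟩ : ∃ x, ev e x = s := ⟨_, ev_ev_inv e s⟩
  have hxs : s < x := by
    rcases Nat.lt_trichotomy x s with hlt | rfl | hlt
    · have := h.fixes x hlt; omega
    · exact absurd hx h0
    · exact hlt
  have hsn : s < n := by
    by_contra! hsn
    exact h0 (ev_of_le e hsn)
  have hxn : x < n := by
    by_contra! hxn
    have := ev_of_le e hxn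
    omega
  rcases Nat.lt_or_ge x (s + 2 * f) with hlt | hge
  · rcases Nat.even_or_odd' (x - s) with ⟨i, hi | hi⟩
    · have h1 := h.left_lt (i - 1) (by omega)
      have h2 := h.fixes.le (x := s + 2 * (i - 1)) (by omega)
      rw [show s + 2 * (i - 1) + 2 = x by omega, hx] at h1
      omega
    · have h1 := h.left_lt_right i (by omega)
      have h2 := h.fixes.le (x := s + 2 * i) (by omega)
      rw [show s + 2 * i + 1 = x by omega, hx] at h1
      omega
  · rcases Nat.eq_or_lt_of_le hge with rfl | hlt
    · exact ⟨hxn, hx⟩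
    · have h1 := h.free_lt (x - 1) (by omega) (by omega)
      have h2 := h.fixes.le (x := x - 1) (by omega)
      rw [show x - 1 + 1 = x by omega, hx] at h1
      omega

theorem arcOrder_mul_asc {s f : ℕ} {e : Equiv.Perm (Fin n)} (hf : 1 ≤ f) (hn : s + 2 * f < n) :
    ArcOrder (s + 1) f e ↔
      ArcOrder s f (e * asc n s (2 * f)) ∧ ev (e * asc n s (2 * f)) s ≠ s := by
  have rel : ∀ x, ev (e * asc n s (2 * f)) x = _ := fun x => by rw [ev_mul, ev_asc (by omega)]
  have r1 : ∀ x, s ≤ x → x < s + 2 * f → ev (e * asc n s (2 * f)) x = ev e (x + 1) :=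
    fun x hx hx' => by rw [rel, if_neg (by omega), if_pos (by omega)]
  have r2 : ev (e * asc n s (2 * f)) (s + 2 * f) = ev e s := by rw [rel, if_pos rfl]
  have r3 : ∀ x, x < s ∨ s + 2 * f < x → ev (e * asc n s (2 * f)) x = ev e x :=
    fun x hx => by rw [rel, if_neg (by omega), if_neg (by omega)]
  constructor
  · intro h
    refine ⟨⟨fun x hx => ?_, fun i hi => ?_, fun i hi => ?_, fun x hx hxn => ?_⟩, ?_⟩
    · rw [r3 x (by omega), h.fixes x (by omega)]
    · rw [r1 _ (by omega) (by omega), r1 _ (by omega) (by omega)]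
      convert h.left_lt i hi using 2 <;> omega
    · rw [r1 _ (by omega) (by omega), r1 _ (by omega) (by omega)]
      convert h.left_lt_right i hi using 2 <;> omega
    · rcases Nat.eq_or_lt_of_le hx with rfl | hx
      · rw [r2, h.fixes s (by omega), r3 _ (by omega)]
        exact h.fixes.le (by omega)
      · rw [r3 _ (by omega), r3 _ (by omega)]
        exact h.free_lt x (by omega) hxn
    · rw [r1 s le_rfl (by omega)]
      have := h.fixes.le (x := s + 1) le_rfl
      omega
  · rintro ⟨h, h0⟩
    have h1 := (h.ev_eq h0).2
    refine ⟨fun x hx => ?_, fun i hi => ?_, fun i hi => ?_, fun x hx hxn => ?_⟩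
    · rcases Nat.lt_succ_iff_lt_or_eq.1 hx with hx | rfl
      · rw [← r3 x (by omega), h.fixes x hx]
      · rw [← r2, h1]
    · have := h.left_lt i hi
      rw [r1 _ (by omega) (by omega), r1 _ (by omega) (by omega)] at this
      convert this using 2 <;> omega
    · have := h.left_lt_right i hi
      rw [r1 _ (by omega) (by omega), r1 _ (by omega) (by omega)] at this
      convert this using 2 <;> omega
    · have := h.free_lt x (by omega) hxn
      rwa [r3 _ (by omega), r3 _ (by omega)] at this

theorem arcSet_zero (s : ℕ) : arcSet n s 0 = {1} := by
  ext d
  rw [mem_arcSet, mem_singleton]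
  refine ⟨fun h => inv_eq_one.1 h.eq_one, ?_⟩
  rintro rfl
  rw [inv_one]
  exact arcOrder_one s

theorem Hset_eq {f : ℕ} (hf : 2 * f ≤ n) : Hset n f = arcSet n 0 f := by
  have hp : ∀ (d : Equiv.Perm (Fin n)) (i : ℕ), i < n → pimg d (i + 1) = ev d⁻¹ i + 1 := by
    intro d i hi
    simp [pimg, ev, hi]
  ext d
  rw [mem_arcSet]
  unfold Hset
  simp only [Finset.mem_filter, mem_univ, true_and, mem_Icc]
  constructor
  · rintro ⟨h1, h2, h3⟩
    refine ⟨fun x hx => by omega, fun i hi => ?_, fun i hi => ?_, fun x hx hxn => ?_⟩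
    · have := h1 (i + 1) (by omega)
      rw [show 2 * (i + 1) - 1 = 2 * i + 1 by omega, hp _ _ (by omega), hp _ _ (by omega)] at this
      simp only [zero_add]
      rw [show 2 * i + 2 = 2 * (i + 1) by omega]
      omega
    · have := h2 (i + 1) (by omega)
      rw [show 2 * (i + 1) - 1 = 2 * i + 1 by omega, show 2 * (i + 1) = 2 * i + 1 + 1 by omega,
        hp _ _ (by omega), hp _ _ (by omega)] at this
      simp only [zero_add]
      omega
    · have := h3 (x + 1) (by omega)
      rw [hp _ _ (by omega), hp _ _ (by omega)] at this
      omega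
  · intro h
    refine ⟨fun i hi => ?_, fun i hi => ?_, fun j hj => ?_⟩
    · obtain ⟨i, rfl⟩ : ∃ k, i = k + 1 := ⟨i - 1, by omega⟩
      have := h.left_lt i (by omega)
      rw [show 2 * (i + 1) - 1 = 2 * i + 1 by omega, hp _ _ (by omega), hp _ _ (by omega),
        show 2 * (i + 1) = 2 * i + 2 by omega]
      simp only [zero_add] at this
      omega
    · obtain ⟨i, rfl⟩ : ∃ k, i = k + 1 := ⟨i - 1, by omega⟩
      have := h.left_lt_right i (by omega)
      rw [show 2 * (i + 1) - 1 = 2 * i + 1 by omega, show 2 * (i + 1) = 2 * i + 1 + 1 by omega,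
        hp _ _ (by omega), hp _ _ (by omega)]
      simp only [zero_add] at this
      omega
    · obtain ⟨j, rfl⟩ : ∃ k, j = k + 1 := ⟨j - 1, by omega⟩
      have := h.free_lt j (by omega) (by omega)
      rw [hp _ _ (by omega), hp _ _ (by omega)]
      omega

end Perm

namespace BMWData

variable {F : Type*} [Field F] {A : Type*} [Ring A] [Algebra F A] {n : ℕ} {q r : F}
variable {D : BMWData F A n q r}

theorem hat_rotate {s f : ℕ} (hf : 1 ≤ f) (hn : s + 2 * f < n) :
    hat q D.Tw ((arcSet n s f).filter fun d => ¬ev d⁻¹ s = s) =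
      q ^ (2 * f) • (D.Dn (s + 1) (2 * f) * hat q D.Tw (arcSet n (s + 1) f)) := by
  have : (arcSet n s f).filter (fun d => ¬ev d⁻¹ s = s) =
      (arcSet n (s + 1) f).image fun d => (asc n s (2 * f))⁻¹ * d := by
    ext d
    simp only [mem_filter, mem_image, mem_arcSet]
    constructor
    · intro h
      refine ⟨asc n s (2 * f) * d, (arcOrder_mul_asc hf hn).2 ?_, by simp⟩
      simpa using h
    · rintro ⟨d, hd, rfl⟩
      simpa using (arcOrder_mul_asc hf hn).1 hd
  rw [hat, this, sum_image fun x _ y _ h => mul_left_cancel h, hat, mul_sum, smul_sum]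
  refine sum_congr rfl fun d hd => ?_
  have hl : len ((asc n s (2 * f))⁻¹ * d) = 2 * f + len d := by
    rw [← len_inv, mul_inv_rev, inv_inv, len_mul_asc (mem_arcSet.1 hd).fixes (by omega), len_inv,
      add_comm]
  rw [D.Tw_mul _ _ (by rw [hl, len_inv, len_asc (by omega)]), D.Tw_asc_inv (by omega), hl, pow_add,
    mul_smul_comm, smul_smul]

theorem hat_fixed {s f k : ℕ} (hk : s + k + 2 = n) :
    hat q D.Tw ((arcSet n s (f + 1)).filter fun d => ev d⁻¹ s = s) =
      hat q D.Tw (arcSet n (s + 2) f) * D.Cc (s + 2) (k + 1) := by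
  refine hat_mul_Cc (t := s + 1) (by omega) (fun d hd => ?_) fun w => ?_
  · have := (mem_arcSet.1 hd).fixes.inv
    rwa [inv_inv] at this
  · simp only [mem_filter, mem_arcSet]
    constructor
    · rintro ⟨h, h0⟩
      have h1 := h.fixes.lt (x := s + 1) (by omega) h0 (by omega)
      have h2 := ev_lt w⁻¹ (x := s + 1) (by omega)
      obtain ⟨j, hj⟩ : ∃ j, ev w⁻¹ (s + 1) = s + 1 + j := ⟨ev w⁻¹ (s + 1) - (s + 1), by omega⟩
      refine ⟨w * (asc n (s + 1) j)⁻¹, ?_, j, by omega, by simp⟩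
      rw [mul_inv_rev, inv_inv, arcOrder_asc_mul (by omega)]
      exact ⟨h, h0, hj⟩
    · rintro ⟨d, hd, j, hj, rfl⟩
      have := (arcOrder_asc_mul (e := (d * asc n (s + 1) j)⁻¹) (f := f) (s := s) (j := j)
        (by omega)).1 (by simpa using hd)
      exact ⟨this.1, this.2.1⟩

theorem hat_arcSet {f s k : ℕ} (hk : s + k = n) (hf : 2 * f ≤ k) :
    hat q D.Tw (arcSet n s f) = D.Hh f (s + 1) k := by
  induction f generalizing s k with
  | zero => rw [arcSet_zero, hat, sum_singleton, len_one, D.Tw_one, pow_zero, one_smul, Hh_zero]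
  | succ f ihf =>
    induction k generalizing s with
    | zero => omega
    | succ k ihk =>
      obtain ⟨k, rfl⟩ : ∃ j, k = j + 1 := ⟨k - 1, by omega⟩
      have hsplit : hat q D.Tw (arcSet n s (f + 1)) =
          hat q D.Tw ((arcSet n s (f + 1)).filter fun d => ev d⁻¹ s = s) +
          hat q D.Tw ((arcSet n s (f + 1)).filter fun d => ¬ev d⁻¹ s = s) :=
        (sum_filter_add_sum_filter_not _ _ _).symm
      rw [hsplit, hat_fixed (k := k) (by omega), ihf (k := k) (by omega) (by omega)]
      change _ = D.Hh (f + 1) (s + 1) (k + 2)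
      rw [Hh_succ]
      congr 1
      rcases Nat.lt_or_ge (2 * f) k with hlt | hge
      · rw [hat_rotate (by omega) (by omega), ihk (by omega) (by omega)]
        rfl
      · rw [D.Hh_eq_zero (f := f + 1) (by omega), mul_zero, smul_zero, hat]
        refine sum_eq_zero fun d hd => ?_
        have h1 := (mem_filter.1 hd)
        have := (mem_arcSet.1 h1.1).ev_eq h1.2
        omega

theorem hat_Hset {f : ℕ} (hf : 2 * f ≤ n) : hat q D.Tw (Hset n f) = D.Hh f 1 n := by
  rw [Hset_eq hf, hat_arcSet (by omega) hf]

end BMWData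

theorem sGen_inv (n i : ℕ) : (sGen n i)⁻¹ = sGen n i := by
  rw [sGen]
  split_ifs
  · exact Equiv.swap_inv _ _
  · exact inv_one

namespace BMWData

open MulOpposite

variable {F : Type*} [Field F] {A : Type*} [Ring A] [Algebra F A] {n : ℕ} {q r : F}
variable (D : BMWData F A n q r)

/-- The BMW structure on the opposite algebra. -/
def op : BMWData F Aᵐᵒᵖ n q r where
  T i := MulOpposite.op (D.T i)
  Tinv i := MulOpposite.op (D.Tinv i)
  E i := MulOpposite.op (D.E i)
  Tw w := MulOpposite.op (D.Tw w⁻¹)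
  hq := D.hq
  hr := D.hr
  hqq := D.hqq
  T_mul_Tinv i h1 h2 := congrArg MulOpposite.op (D.Tinv_mul_T i h1 h2)
  Tinv_mul_T i h1 h2 := congrArg MulOpposite.op (D.T_mul_Tinv i h1 h2)
  skein i h1 h2 := congrArg MulOpposite.op (D.skein i h1 h2)
  Esq i h1 h2 := congrArg MulOpposite.op (D.Esq i h1 h2)
  braid i h1 h2 := by
    simpa only [MulOpposite.op_mul, mul_assoc] using congrArg MulOpposite.op (D.braid i h1 h2)
  T_comm i j h1 h2 h3 h4 h5 := congrArg MulOpposite.op (D.T_comm i j h1 h2 h3 h4 h5).symm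
  EEE₁ i h1 h2 := by
    simpa only [MulOpposite.op_mul, mul_assoc] using congrArg MulOpposite.op (D.EEE₁ i h1 h2)
  EEE₂ i h1 h2 := by
    simpa only [MulOpposite.op_mul, mul_assoc] using congrArg MulOpposite.op (D.EEE₂ i h1 h2)
  TTE₁ i h1 h2 := by
    simpa only [MulOpposite.op_mul, mul_assoc] using
      congrArg MulOpposite.op (D.E_mul_T_mul_T h1 (by omega))
  TTE₂ i h1 h2 := by
    simpa only [MulOpposite.op_mul, mul_assoc] using
      congrArg MulOpposite.op (D.E_succ_mul_T_mul_T h1 (by omega))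
  ET i h1 h2 := congrArg MulOpposite.op (D.TE i h1 h2)
  TE i h1 h2 := congrArg MulOpposite.op (D.ET i h1 h2)
  ETE₁ i h1 h2 := by
    simpa only [MulOpposite.op_mul, MulOpposite.op_smul, mul_assoc] using
      congrArg MulOpposite.op (D.ETE₁ i h1 h2)
  ETE₂ i h1 h2 := by
    simpa only [MulOpposite.op_mul, MulOpposite.op_smul, mul_assoc] using
      congrArg MulOpposite.op (D.ETE₂ i h1 h2)
  Tw_one := by rw [inv_one, D.Tw_one, MulOpposite.op_one]
  Tw_s i h1 h2 := by rw [sGen_inv, D.Tw_s i h1 h2]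
  Tw_mul u v h := by
    rw [mul_inv_rev, D.Tw_mul, MulOpposite.op_mul]
    rw [← mul_inv_rev, len_inv, len_inv, len_inv, h, add_comm]

/-- The same algebra with `-q⁻¹` in place of `q`. -/
def neg : BMWData F A n (-q⁻¹) r :=
  have h : -q⁻¹ - (-q⁻¹)⁻¹ = q - q⁻¹ := by rw [inv_neg, inv_inv]; ring
  { T := D.T
    Tinv := D.Tinv
    E := D.E
    Tw := D.Tw
    hq := neg_ne_zero.2 (inv_ne_zero D.hq)
    hr := D.hr
    hqq := by rw [h]; exact D.hqq
    T_mul_Tinv := D.T_mul_Tinv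
    Tinv_mul_T := D.Tinv_mul_T
    skein := by rw [h]; exact D.skein
    Esq := by rw [h]; exact D.Esq
    braid := D.braid
    T_comm := D.T_comm
    EEE₁ := D.EEE₁
    EEE₂ := D.EEE₂
    TTE₁ := D.TTE₁
    TTE₂ := D.TTE₂
    ET := D.ET
    TE := D.TE
    ETE₁ := D.ETE₁
    ETE₂ := D.ETE₂
    Tw_one := D.Tw_one
    Tw_s := D.Tw_s
    Tw_mul := D.Tw_mul }

theorem xEl_neg (f : ℕ) : xEl D.neg f = xElCheck D f := rfl

theorem unop_hat_op (S : Finset (Equiv.Perm (Fin n))) :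
    unop (hat q D.op.Tw S) = hat q D.Tw (S.image fun d => d⁻¹) := by
  rw [hat, hat, sum_image fun _ _ _ _ h => inv_injective h, unop_sum]
  exact sum_congr rfl fun w _ => by rw [len_inv]; rfl

theorem image_inv_fixSet (t : ℕ) : (fixSet n t).image (fun d => d⁻¹) = fixSet n t := by
  ext w
  simp only [fixSet, mem_image, Finset.mem_filter, mem_univ, true_and]
  constructor
  · rintro ⟨d, hd, rfl⟩ a ha
    rw [Equiv.Perm.inv_eq_iff_eq, hd a ha]
  · exact fun h => ⟨w⁻¹, fun a ha => by rw [Equiv.Perm.inv_eq_iff_eq, h a ha], inv_inv w⟩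

theorem op_Ehat {f : ℕ} (hf : 2 * f ≤ n) :
    MulOpposite.op (Ehat D.E f) = Ehat D.op.E f := by
  induction f with
  | zero => rfl
  | succ f ih =>
    have : Commute (D.E (2 * f + 1)) (Ehat D.E f) := commute_Ehat fun i hi =>
      D.commute_E_E (by omega) (by omega) (by omega) (by omega) (by omega)
    rw [Ehat_succ, Ehat_succ, ← ih (by omega), ← this.eq, MulOpposite.op_mul]
    rfl

/-- The left factor of `xEl D f`. -/
noncomputable def leftEl (f : ℕ) : A :=
  hat q D.Tw ((Hset n f).image fun d => d⁻¹) * hat q D.Tw (fixSet n (2 * f)) * Ehat D.E f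

theorem op_leftEl {f : ℕ} (hf : 2 * f ≤ n) :
    MulOpposite.op (D.leftEl f) =
      Ehat D.op.E f * D.op.Sh (2 * f + 1) (n - 2 * f) * D.op.Hh f 1 n := by
  rw [leftEl, ← image_inv_fixSet, ← unop_hat_op, ← unop_hat_op, hat_Hset hf,
    hat_fixSet (k := n - 2 * f) (by omega), MulOpposite.op_mul, MulOpposite.op_mul, D.op_Ehat hf,
    mul_assoc]
  rfl

theorem tower_leftEl : D.Tower D.leftEl where
  good f hf := by
    rw [leftEl, hat_fixSet (k := n - 2 * f) (by omega), mul_assoc]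
    exact ((good_Sh _ (by omega) (by omega)).mul_right (by omega) (by omega) fun j h1 h2 =>
      (commute_Ehat fun i hi => (D.commute_E_T (by omega) (by omega) (by omega) (by omega)
        (by omega)).symm).symm).mul_left _
  ends f hf i hi := (ends_Ehat hf hi).mul_left _
  defect_eq f hf := by
    apply MulOpposite.op_injective
    have := T_sub_mul_left (D := D.op) hf
    rw [← op_leftEl _ (by omega), ← op_leftEl _ (by omega)] at this
    rw [D.defect_eq, MulOpposite.op_mul, MulOpposite.op_smul]
    exact this

theorem tow_leftEl {f : ℕ} (hf : 2 * f ≤ n) :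
    D.tow D.leftEl 0 f = (∏ i ∈ range f, qnum q (i + 1)) • xEl D f := by
  rw [D.tower_leftEl.tow_eq (by omega), zero_add, xEl, hat_Hset hf]
  rfl

theorem mul_E_eq_zero {y : A} {i : ℕ} (hi : 1 ≤ i) (hin : i < n) (h : y * D.T i = q • y) :
    y * D.E i = 0 := by
  have h' : y * D.Tinv i = q⁻¹ • y := by
    rw [eq_inv_smul_iff₀ D.hq, ← smul_mul_assoc, ← h, mul_assoc, D.T_mul_Tinv i hi (by omega),
      mul_one]
  rw [D.E_eq hi hin, mul_sub, mul_smul_comm, mul_sub, h, h', mul_one, ← sub_smul, smul_smul,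
    inv_mul_cancel₀ D.hqq, one_smul, sub_self]

end BMWData

section Coefficients

variable {F : Type*} [Field F]

/-- The coefficients of the symmetrizer with respect to the elements `BMWData.tow`. -/
noncomputable def towCoeff (q r : F) (n : ℕ) : ℕ → F
  | 0 => 1
  | f + 1 => towCoeff q r n f * (q ^ (2 * f) * (q ^ 2 - 1)) /
      (1 - r * q ^ (2 * (n - 2 * (f + 1)) + 2 * f) * q)

theorem qnum_mul (q : F) (k : ℕ) : qnum q k * (q ^ 2 - 1) = q ^ (2 * k) - 1 := by
  simp only [qnum, pow_mul, geom_sum_mul]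

theorem add_mul_zpow_eq {q : F} (hq : q ≠ 0) (r : F) {n f k : ℕ} (h : n = 2 * (f + 1) + k) :
    q + r * q ^ ((2 : ℤ) + 2 * ((f : ℤ) + 1) - 2 * (n : ℤ)) =
      q * (1 - r * (-q⁻¹) ^ (2 * k + 2 * f) * (-q⁻¹)) := by
  rw [show (2 : ℤ) + 2 * ((f : ℤ) + 1) - 2 * (n : ℤ) = -((2 * k + 2 * f : ℕ) : ℤ) by
    subst h; push_cast; ring, zpow_neg, zpow_natCast, Even.neg_pow ⟨k + f, by ring⟩, inv_pow]
  field_simp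
  ring

theorem ccseq_eq {q : F} (hq : q ≠ 0) (r : F) {n f : ℕ} (hf : 2 * f ≤ n)
    (hden : ∀ f : ℕ, 1 ≤ f → 2 * f ≤ n →
      q + r * q ^ ((2 : ℤ) + 2 * (f : ℤ) - 2 * (n : ℤ)) ≠ 0) :
    ccseq q r n f = towCoeff (-q⁻¹) r n f * ∏ i ∈ range f, qnum (-q⁻¹) (i + 1) := by
  induction f with
  | zero => simp [ccseq, towCoeff]
  | succ f ih =>
    obtain ⟨k, hk⟩ : ∃ k, n = 2 * (f + 1) + k := ⟨n - 2 * (f + 1), by omega⟩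
    have h0 := hden (f + 1) (by omega) hf
    push_cast at h0
    have hd := add_mul_zpow_eq hq r hk
    rw [ccseq, towCoeff, ih (by omega), prod_range_succ, hd]
    rw [hd] at h0
    rw [show n - 2 * (f + 1) = k by omega]
    have h1 := right_ne_zero_of_mul h0
    have hQ := qnum_mul (-q⁻¹) (f + 1)
    have e : q ^ ((3 : ℤ) - 4 * ((f : ℤ) + 1)) * (1 - q ^ (2 * (f + 1))) =
        q * ((-q⁻¹) ^ (2 * f) * ((-q⁻¹) ^ (2 * (f + 1)) - 1)) := by
      rw [show (3 : ℤ) - 4 * ((f : ℤ) + 1) = -((4 * f + 1 : ℕ) : ℤ) by push_cast; ring, zpow_neg,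
        zpow_natCast, Even.neg_pow ⟨f, by ring⟩, Even.neg_pow ⟨f + 1, by ring⟩, inv_pow, inv_pow]
      field_simp
      ring
    rw [e, ← hQ]
    generalize 1 - r * (-q⁻¹) ^ (2 * k + 2 * f) * (-q⁻¹) = d at *
    generalize -q⁻¹ = p at *
    field_simp

theorem towCoeff_succ {q r : F} {n : ℕ} (hq : q ≠ 0)
    (hden : ∀ f : ℕ, 1 ≤ f → 2 * f ≤ n →
      q + r * q ^ ((2 : ℤ) + 2 * (f : ℤ) - 2 * (n : ℤ)) ≠ 0) (f k : ℕ) (h : n = 2 * (f + 1) + k) :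
    towCoeff (-q⁻¹) r n (f + 1) * (1 - r * (-q⁻¹) ^ (2 * k + 2 * f) * (-q⁻¹)) =
      towCoeff (-q⁻¹) r n f * (-q⁻¹) ^ (2 * f) * ((-q⁻¹) ^ 2 - 1) := by
  have h0 := hden (f + 1) (by omega) (by omega)
  push_cast at h0
  rw [add_mul_zpow_eq hq r h] at h0
  rw [towCoeff, show n - 2 * (f + 1) = k by omega, div_mul_cancel₀ _ (right_ne_zero_of_mul h0),
    mul_assoc]

end Coefficients

/-- With `č_0 = 1` and
`č_f = (q^{3-4f}(1 - q^{2f})/(q + rq^{2+2f-2n})) č_{f-1}` (the denominators being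
assumed nonzero), the element `y = Σ_{f=0}^{⌊n/2⌋} č_f x̌_f` satisfies `y E_i = 0` and
`y T_i = -q⁻¹ y` for `i = 1, …, n-1`: it is, up to scalars, the antisymmetrizer. -/
theorem statement19 {F : Type*} [Field F] {A : Type*} [Ring A] [Algebra F A]
    {n : ℕ} (hn : 1 ≤ n) {q r : F} (D : BMWData F A n q r)
    (hden : ∀ f : ℕ, 1 ≤ f → 2 * f ≤ n →
      q + r * q ^ ((2 : ℤ) + 2 * (f : ℤ) - 2 * (n : ℤ)) ≠ 0) :
    ∀ i, 1 ≤ i → i ≤ n - 1 →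
      (∑ f ∈ Finset.range (n / 2 + 1), ccseq q r n f • xElCheck D f) * D.E i = 0 ∧
      (∑ f ∈ Finset.range (n / 2 + 1), ccseq q r n f • xElCheck D f) * D.T i =
        (-q⁻¹) • ∑ f ∈ Finset.range (n / 2 + 1), ccseq q r n f • xElCheck D f := by
  intro i hi hin
  have hsum : ∑ f ∈ Finset.range (n / 2 + 1), ccseq q r n f • xElCheck D f =
      ∑ f ∈ Finset.range (n / 2 + 1), towCoeff (-q⁻¹) r n f • D.neg.tow D.neg.leftEl 0 f := by
    refine sum_congr rfl fun f hf => ?_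
    have hf : 2 * f ≤ n := by have := mem_range.1 hf; omega
    rw [D.neg.tow_leftEl hf, smul_smul, ← ccseq_eq D.hq r hf hden, D.xEl_neg]
  rw [hsum]
  have hT := D.neg.tower_leftEl.sum_mul_T (towCoeff_succ D.hq hden) hi (by omega)
  exact ⟨D.neg.mul_E_eq_zero hi (by omega) hT, hT⟩

end BMWPaper
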